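/- arXiv:2312.08911 — 8 statements merged into one kernel-verified Lean document; each statement's English description precedes it below -/
import Mathlib

section
/- Let m : ℕ, F ⊆ Fin m × Fin m a set of forbidden adjacent pairs, and a₀ : Fin m. There exists x : ℤ → Fin m such that (x n, x (n+1)) ∉ F for every n : ℤ and the set {n : ℤ | x n = a₀} is infinite, if and only if there exist N ≥ 1 and c : Fin (N+1) → Fin m with c 0 = a₀, c N = a₀, and (c j, c (j+1)) ∉ F for every j < N. -/
/-- A nearest-neighbour `ℤ`-configuration avoiding `F` in which the letter `a₀`
occurs infinitely often exists iff the tileset graph contains a cycle based at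
`a₀`. -/
theorem recurring_Z_iff_cycle (m : ℕ) (F : Set (Fin m × Fin m)) (a₀ : Fin m) :
    (∃ x : ℤ → Fin m,
      (∀ n : ℤ, (x n, x (n + 1)) ∉ F) ∧ {n : ℤ | x n = a₀}.Infinite) ↔
    (∃ N : ℕ, 1 ≤ N ∧ ∃ c : Fin (N + 1) → Fin m,
      c 0 = a₀ ∧ c (Fin.last N) = a₀ ∧
      ∀ j : Fin N, (c j.castSucc, c j.succ) ∉ F) := by
  constructor
  · rintro ⟨x, hx, hinf⟩
    obtain ⟨a, ha, b, hb, hab⟩ := hinf.nontrivial.exists_lt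
    simp only [Set.mem_ofPred_eq] at ha hb
    refine ⟨(b - a).toNat, by omega, fun j => x (a + (j : ℕ)), by simpa using ha, ?_, fun j => ?_⟩
    · have h : a + ((b - a).toNat : ℤ) = b := by omega
      simpa only [Fin.val_last, h] using hb
    · simpa [add_assoc] using hx (a + (j : ℕ))
  · rintro ⟨N, hN, c, h0, hlast, hc⟩
    have hpos : (0 : ℤ) < N := by omega
    have hlt (n : ℤ) : (n % N).toNat < N := by
      have := Int.emod_nonneg n hpos.ne'
      have := Int.emod_lt_of_pos n hpos
      omega
    refine ⟨fun n => c (Fin.castSucc ⟨(n % N).toNat, hlt n⟩), fun n => ?_, ?_⟩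
    · have key : c (Fin.castSucc ⟨((n + 1) % N).toNat, hlt (n + 1)⟩) =
          c (Fin.succ ⟨(n % N).toNat, hlt n⟩) := by
        have hnonneg := Int.emod_nonneg n hpos.ne'
        have hmod : (n + 1) % N = (n % N + 1) % N := by simp
        rcases (Int.add_one_le_of_lt (Int.emod_lt_of_pos n hpos)).lt_or_eq with h | h
        · rw [Int.emod_eq_of_lt (by omega) h] at hmod
          congr 1
          ext
          simp only [Fin.val_castSucc, Fin.val_succ]
          omega
        · rw [h, Int.emod_self] at hmod
          have hzero : Fin.castSucc ⟨((n + 1) % N).toNat, hlt (n + 1)⟩ = (0 : Fin (N + 1)) := by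
            ext
            simp [hmod]
          have htop : Fin.succ ⟨(n % N).toNat, hlt n⟩ = Fin.last N := by
            ext
            simp only [Fin.val_succ, Fin.val_last]
            omega
          rw [hzero, htop, h0, hlast]
      simpa only [key] using hc ⟨(n % N).toNat, hlt n⟩
    · refine Set.infinite_of_injective_forall_mem (f := fun k : ℤ => k * N)
        (mul_left_injective₀ hpos.ne') fun k => ?_
      simpa using h0
end

section
/- The recurring domino problem on ℤ is decidable: the predicate on triples ⟨m, F, a₀⟩, where m : ℕ, F : Finset (Fin m × Fin m) and a₀ : Fin m, asserting that there exists x : ℤ → Fin m with (x n, x (n+1)) ∉ F for every n : ℤ and with {n : ℤ | x n = a₀} infinite, is ComputablePred with respect to a natural Primcodable encoding of such triples. -/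
/-- An instance of the recurring domino problem on `ℤ` (with the single
generator `1`): an alphabet size `m`, a finite set of forbidden adjacent pairs,
and a target letter `a₀ : Fin m`. -/
abbrev RDPZInstance : Type := Σ m : ℕ, Finset (Fin m × Fin m) × Fin m

instance : Infinite RDPZInstance :=
  Infinite.of_injective (fun n => (⟨n + 1, ∅, 0⟩ : RDPZInstance)) fun a b h => by
    have : a + 1 = b + 1 := congrArg Sigma.fst h
    omega

noncomputable instance : Denumerable RDPZInstance :=
  Denumerable.ofEncodableOfInfinite _

open Encodable

theorem Relation.TransGen.exists_seq {α : Type*} {r : α → α → Prop} {a b : α}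
    (h : Relation.TransGen r a b) :
    ∃ (k : ℕ) (f : ℕ → α), f 0 = a ∧ f (k + 1) = b ∧ ∀ i ≤ k, r (f i) (f (i + 1)) := by
  induction h using Relation.TransGen.head_induction_on with
  | @single c h => exact ⟨0, fun n => Nat.casesOn n c fun _ => b, rfl, rfl, by simpa using h⟩
  | @head c d hcd _ ih =>
    obtain ⟨k, f, h0, hk, hf⟩ := ih
    refine ⟨k + 1, fun n => Nat.casesOn n c f, rfl, hk, fun i hi => ?_⟩
    cases i with
    | zero => simpa [h0] using hcd
    | succ i => exact hf i (by omega)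

/-- A bi-infinite walk visiting `a` infinitely often exists iff `a` lies on a cycle. -/
theorem exists_recurrent_walk_iff_transGen {α : Type*} (r : α → α → Prop) (a : α) :
    (∃ x : ℤ → α, (∀ n, r (x n) (x (n + 1))) ∧ {n | x n = a}.Infinite) ↔
      Relation.TransGen r a a := by
  constructor
  · rintro ⟨x, hx, hinf⟩
    obtain ⟨n, hn, n', hn', hlt⟩ := hinf.nontrivial.exists_lt
    have walk (k : ℕ) : Relation.TransGen r (x n) (x (n + k + 1)) := by
      induction k with
      | zero => simpa using .single (hx n)
      | succ k ih => simpa [add_assoc] using ih.tail (hx _)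
    have := walk (n' - n - 1).toNat
    rwa [show n + ((n' - n - 1).toNat : ℤ) + 1 = n' by omega, hn, hn'] at this
  · intro h
    obtain ⟨k, f, h0, hk, hf⟩ := h.exists_seq
    have hpos : (0 : ℤ) < k + 1 := by omega
    refine ⟨fun n => f (n % (k + 1)).toNat, fun n => ?_, ?_⟩
    · have h1 := Int.emod_nonneg n hpos.ne'
      have h2 := Int.emod_lt_of_pos n hpos
      have h3 : (n + 1) % (k + 1 : ℤ) = (n % (k + 1) + 1) % (k + 1) :=
        (Int.emod_add_emod n _ 1).symm
      have hstep := hf (n % (k + 1)).toNat (by zify; omega)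
      by_cases hlast : n % (k + 1 : ℤ) = k
      · rw [hlast, Int.emod_self] at h3
        simpa [h3, hlast, hk, h0] using hstep
      · have h4 := h3.trans (Int.emod_eq_of_lt (by omega) (by omega))
        simpa only [h4, Int.toNat_add h1 zero_le_one, Int.toNat_one] using hstep
    · refine Set.infinite_of_injective_forall_mem (f := fun n : ℤ => n * (k + 1)) ?_ ?_
      · exact fun u v huv => mul_right_cancel₀ hpos.ne' huv
      · intro n
        simp [h0]

/-- `a` lies on no cycle iff some set, given as a bitmask, is closed under successors and
contains the successors of `a` but not `a`. -/
theorem transGen_self_iff_forall_testBit {m : ℕ} (r : Fin m → Fin m → Prop) (a : Fin m) :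
    Relation.TransGen r a a ↔ ¬ ∃ S < 2 ^ m, (∀ j, r a j → S.testBit j) ∧
      (∀ i : Fin m, S.testBit i → ∀ j, r i j → S.testBit j) ∧ ¬ S.testBit a := by
  constructor
  · rintro h ⟨S, -, hsucc, hclosed, ha⟩
    have mem (b : Fin m) (hb : Relation.TransGen r a b) : S.testBit b := by
      induction hb with
      | single hb => exact hsucc _ hb
      | tail _ hbc ih => exact hclosed _ ih _ hbc
    exact ha (mem a h)
  · classical
    intro h
    by_contra hcyc
    have bit (i : Fin m) : (Nat.ofBits fun j => decide (Relation.TransGen r a j)).testBit i ↔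
        Relation.TransGen r a i := by
      rw [Nat.testBit_ofBits_lt _ _ i.2]
      simp
    refine h ⟨Nat.ofBits fun j => decide (Relation.TransGen r a j), Nat.ofBits_lt_two_pow _, ?_⟩
    simp only [bit]
    exact ⟨fun j hj => .single hj, fun i hi j hj => hi.tail hj, hcyc⟩

theorem Finset.exists_encode_eq_encode_list {α : Type*} [Encodable α] (s : Finset α) :
    ∃ l : List α, encode s = encode l ∧ (∀ a, a ∈ l ↔ a ∈ s) ∧
      (l.map encode).Pairwise (· < ·) := by
  have hlin : IsLinearOrder α (encode ⁻¹'o (· ≤ ·)) :=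
    (RelEmbedding.preimage ⟨encode, encode_injective⟩ (· ≤ ·)).isLinearOrder
  obtain ⟨l, hl, hs, hle⟩ : ∃ l : List α, encode s = encode l ∧ (l : Multiset α) = s.1 ∧
      l.Pairwise (encode ⁻¹'o (· ≤ ·)) :=
    ⟨_, rfl, @Multiset.sort_eq _ _ _ _ hlin.toIsTrans hlin.toAntisymm hlin.toTotal,
      @Multiset.pairwise_sort _ _ _ _ hlin.toIsTrans hlin.toAntisymm hlin.toTotal⟩
  refine ⟨l, hl, fun a => by rw [← Finset.mem_val, ← hs, Multiset.mem_coe], ?_⟩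
  have hnd : l.Nodup := by rw [← Multiset.coe_nodup, hs]; exact s.2
  rw [List.pairwise_map]
  exact (hle.and hnd).imp fun h => lt_of_le_of_ne h.1 (encode_injective.ne h.2)

theorem List.encode_map_encode {α : Type*} [Encodable α] (l : List α) :
    encode (l.map encode) = encode l := by
  induction l with
  | nil => rfl
  | cons a l ih => simp [encode_list_cons, ih]

section

variable {β : Type*} [Primcodable β] {R : ℕ → β → Prop}

theorem PrimrecRel.exists_lt_of_param (hR : PrimrecRel R) :
    PrimrecRel fun n b => ∃ k < n, R k b :=
  (hR.exists_mem_list.comp (Primrec.list_range.comp Primrec.fst) Primrec.snd).of_eq (by simp)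

theorem PrimrecRel.forall_lt_of_param (hR : PrimrecRel R) :
    PrimrecRel fun n b => ∀ k < n, R k b :=
  (hR.forall_mem_list.comp (Primrec.list_range.comp Primrec.fst) Primrec.snd).of_eq (by simp)

end

namespace RDPZInstance

theorem exists_numerals (I : RDPZInstance) : ∃ l : List ℕ,
    Sigma.encodable.encode I = encode (I.1, l, (I.2.2 : ℕ)) ∧ l.Pairwise (· < ·) ∧
    ∀ e, e ∈ l ↔ ∃ p : Fin I.1 × Fin I.1, p ∈ I.2.1 ∧ Nat.pair p.1 p.2 = e := by
  obtain ⟨m, F, a⟩ := I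
  obtain ⟨l, hl, hmem, hlt⟩ := F.exists_encode_eq_encode_list
  refine ⟨l.map encode, ?_, hlt, fun e => ?_⟩
  · rw [Encodable.encode_prod_val, Encodable.encode_prod_val, List.encode_map_encode, ← hl]
    rfl
  · simp only [List.mem_map, hmem]
    rfl

/-- The size, the increasing list of codes of the forbidden pairs, and the target letter. -/
noncomputable def numerals (I : RDPZInstance) : ℕ × List ℕ × ℕ :=
  (I.1, I.exists_numerals.choose, (I.2.2 : ℕ))

theorem encode_numerals (I : RDPZInstance) : encode I.numerals = Sigma.encodable.encode I :=
  I.exists_numerals.choose_spec.1.symm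

/-- The triples of the form `numerals I`. -/
def IsNumerals (t : ℕ × List ℕ × ℕ) : Prop :=
  t.2.2 < t.1 ∧ t.2.1 = (List.range (Nat.pair t.1 t.1)).filter fun e =>
    e.unpair.1 < t.1 ∧ e.unpair.2 < t.1 ∧ e ∈ t.2.1

theorem pairwise_of_isNumerals {t : ℕ × List ℕ × ℕ} (h : IsNumerals t) :
    t.2.1.Pairwise (· < ·) := by
  rw [h.2]
  exact List.pairwise_lt_range.filter _

theorem isNumerals_numerals (I : RDPZInstance) : IsNumerals I.numerals := by
  obtain ⟨-, hlt, hmem⟩ := I.exists_numerals.choose_spec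
  refine ⟨I.2.2.2, hlt.eq_of_mem_iff (List.pairwise_lt_range.filter _) fun e => ?_⟩
  simp only [List.mem_filter, List.mem_range, decide_eq_true_eq]
  refine ⟨fun he => ?_, fun he => he.2.2.2⟩
  obtain ⟨p, -, rfl⟩ := (hmem e).1 he
  rw [Nat.unpair_pair]
  exact ⟨(Nat.pair_lt_pair_left _ p.1.2).trans (Nat.pair_lt_pair_right _ p.2.2), p.1.2, p.2.2, he⟩

theorem exists_numerals_eq {t : ℕ × List ℕ × ℕ} (ht : IsNumerals t) :
    ∃ I : RDPZInstance, I.numerals = t := by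
  obtain ⟨m, l, a⟩ := t
  refine ⟨⟨m, ({p | Nat.pair p.1 p.2 ∈ l} : Finset (Fin m × Fin m)), ⟨a, ht.1⟩⟩, ?_⟩
  obtain ⟨-, hlt, hmem⟩ := (exists_numerals
    ⟨m, ({p | Nat.pair p.1 p.2 ∈ l} : Finset (Fin m × Fin m)), ⟨a, ht.1⟩⟩).choose_spec
  refine Prod.ext rfl (Prod.ext (hlt.eq_of_mem_iff (pairwise_of_isNumerals ht) fun e => ?_) rfl)
  rw [hmem]
  simp only [Finset.mem_filter, Finset.mem_univ, true_and]
  constructor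
  · rintro ⟨p, hp, rfl⟩
    exact hp
  · intro he
    have he' := he
    rw [show l = _ from ht.2] at he'
    simp only [List.mem_filter, decide_eq_true_eq] at he'
    exact ⟨(⟨_, he'.2.1⟩, ⟨_, he'.2.2.1⟩), by simpa using he, by simp⟩

theorem mem_range_encode_iff (k : ℕ) :
    k ∈ Set.range (Sigma.encodable.encode : RDPZInstance → ℕ) ↔
      IsNumerals (Denumerable.ofNat (ℕ × List ℕ × ℕ) k) := by
  constructor
  · rintro ⟨I, rfl⟩
    rw [← encode_numerals, Denumerable.ofNat_encode]
    exact isNumerals_numerals I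
  · intro h
    obtain ⟨I, hI⟩ := exists_numerals_eq h
    exact ⟨I, by rw [← encode_numerals, hI, Denumerable.encode_ofNat]⟩

open Classical in
theorem encode_eq_length_filter (I : RDPZInstance) :
    Primcodable.toEncodable.encode I = ((List.range (encode I.numerals)).filter fun k =>
      IsNumerals (Denumerable.ofNat (ℕ × List ℕ × ℕ) k)).length := by
  rw [encode_numerals, ← List.countP_eq_length_filter]
  simp only [← mem_range_encode_iff]
  let : DecidablePred (· ∈ Set.range (Sigma.encodable.encode : RDPZInstance → ℕ)) :=
    decidableRangeEncode _
  have h : Primcodable.toEncodable.encode I = (List.range (Sigma.encodable.encode I)).countP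
    (· ∈ Set.range (Sigma.encodable.encode : RDPZInstance → ℕ)) := rfl
  convert h

theorem primrecRel_mem_list : PrimrecRel fun (e : ℕ) (l : List ℕ) => e ∈ l :=
  (PrimrecRel.exists_mem_list Primrec.eq).comp Primrec.snd Primrec.fst |>.of_eq fun _ => by simp

theorem primrecPred_isNumerals : PrimrecPred IsNumerals := by
  classical
  have hlen : Primrec fun t : ℕ × List ℕ × ℕ => t.1 := Primrec.fst
  have hlist : Primrec fun t : ℕ × List ℕ × ℕ => t.2.1 := Primrec.fst.comp Primrec.snd
  have hkeep : PrimrecRel fun (e : ℕ) (t : ℕ × List ℕ × ℕ) =>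
      e.unpair.1 < t.1 ∧ e.unpair.2 < t.1 ∧ e ∈ t.2.1 :=
    (Primrec.nat_lt.comp (Primrec.fst.comp (Primrec.unpair.comp Primrec.fst))
      (hlen.comp Primrec.snd)).and <|
    (Primrec.nat_lt.comp (Primrec.snd.comp (Primrec.unpair.comp Primrec.fst))
      (hlen.comp Primrec.snd)).and <|
    primrecRel_mem_list.comp Primrec.fst (hlist.comp Primrec.snd)
  refine (Primrec.nat_lt.comp (Primrec.snd.comp Primrec.snd) hlen).and (Primrec.eq.comp hlist ?_)
  exact (hkeep.listFilter.comp
    (Primrec.list_range.comp (Primrec₂.natPair.comp hlen hlen)) Primrec.id).of_eq fun t => by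
      congr

theorem computable_numerals : Computable numerals := by
  classical
  have hnum : PrimrecPred fun k => IsNumerals (Denumerable.ofNat (ℕ × List ℕ × ℕ) k) :=
    primrecPred_isNumerals.comp (Primrec.ofNat _)
  have hsearch : PrimrecRel fun (I : RDPZInstance) (k : ℕ) =>
      IsNumerals (Denumerable.ofNat (ℕ × List ℕ × ℕ) k) ∧
      ((List.range k).filter fun k =>
        IsNumerals (Denumerable.ofNat (ℕ × List ℕ × ℕ) k)).length = Primcodable.toEncodable.encode I :=
    (hnum.comp Primrec.snd).and <| Primrec.eq.comp
      (Primrec.list_length.comp ((Primrec.listFilter hnum).comp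
        (Primrec.list_range.comp Primrec.snd)))
      (Primrec.encode.comp Primrec.fst)
  have hcode : Computable fun I : RDPZInstance => encode I.numerals := by
    refine (Partrec.rfind (p := fun I k => Part.some (decide
      (IsNumerals (Denumerable.ofNat (ℕ × List ℕ × ℕ) k) ∧
      ((List.range k).filter fun k =>
        IsNumerals (Denumerable.ofNat (ℕ × List ℕ × ℕ) k)).length =
          Primcodable.toEncodable.encode I)))
      hsearch.decide.to_comp.partrec).of_eq_tot fun I => ?_
    have hI : IsNumerals (Denumerable.ofNat (ℕ × List ℕ × ℕ) (encode I.numerals)) := by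
      rw [Denumerable.ofNat_encode]
      exact I.isNumerals_numerals
    refine Nat.mem_rfind.2 ⟨Part.mem_some_iff.2
      (decide_eq_true ⟨hI, I.encode_eq_length_filter.symm⟩).symm, fun {k} hk =>
      Part.mem_some_iff.2 (decide_eq_false (not_and.2 fun hk' heq => ?_)).symm⟩
    rw [encode_eq_length_filter] at heq
    have := Nat.count_strict_mono
      (p := fun k => IsNumerals (Denumerable.ofNat (ℕ × List ℕ × ℕ) k)) hk' hk
    simp only [Nat.count_eq_card_filter_range] at this
    exact this.ne heq
  exact ((Computable.ofNat _).comp hcode).of_eq fun I => Denumerable.ofNat_encode _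

/-- The bitmask criterion of `transGen_self_iff_forall_testBit` on numerals. -/
def NoSeparator (t : ℕ × List ℕ × ℕ) : Prop :=
  ¬ ∃ S < 2 ^ t.1, (∀ j < t.1, Nat.pair t.2.2 j ∉ t.2.1 → S.testBit j) ∧
    (∀ i < t.1, S.testBit i → ∀ j < t.1, Nat.pair i j ∉ t.2.1 → S.testBit j) ∧
    ¬ S.testBit t.2.2

theorem pair_mem_numerals (I : RDPZInstance) (i j : Fin I.1) :
    Nat.pair i j ∈ I.numerals.2.1 ↔ (i, j) ∈ I.2.1 := by
  refine (I.exists_numerals.choose_spec.2.2 _).trans ⟨?_, fun h => ⟨_, h, rfl⟩⟩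
  rintro ⟨⟨i', j'⟩, hp, h⟩
  obtain ⟨hi, hj⟩ := Nat.pair_eq_pair.1 h
  rwa [← Fin.ext hi, ← Fin.ext hj]

theorem noSeparator_numerals_iff (I : RDPZInstance) :
    NoSeparator I.numerals ↔ Relation.TransGen (fun i j => (i, j) ∉ I.2.1) I.2.2 I.2.2 := by
  rw [transGen_self_iff_forall_testBit]
  simp only [← pair_mem_numerals, Fin.forall_iff]
  rfl

theorem primrec_two_pow : Primrec fun n : ℕ => 2 ^ n :=
  (Primrec₂.unpaired'.1 Nat.Primrec.pow).comp (Primrec.const 2) Primrec.id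

theorem primrecRel_testBit : PrimrecRel fun S i : ℕ => S.testBit i := by
  refine (Primrec.eq.comp (Primrec.nat_mod.comp (Primrec.nat_div.comp Primrec.fst
    (primrec_two_pow.comp Primrec.snd))
    (Primrec.const 2)) (Primrec.const 1)).of_eq fun p => ?_
  simp [Nat.testBit_eq_decide_div_mod_eq]

theorem primrecPred_noSeparator : PrimrecPred NoSeparator := by
  have hedge : PrimrecRel fun (j : ℕ) (q : ℕ × ℕ × ℕ × List ℕ × ℕ) =>
      Nat.pair q.1 j ∉ q.2.2.2.1 → q.2.1.testBit j := by
    refine ((primrecRel_mem_list.comp (Primrec₂.natPair.comp (Primrec.fst.comp Primrec.snd)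
      Primrec.fst) (Primrec.fst.comp <| Primrec.snd.comp <| Primrec.snd.comp <|
        Primrec.snd.comp Primrec.snd)).or (primrecRel_testBit.comp
      (Primrec.fst.comp <| Primrec.snd.comp Primrec.snd) Primrec.fst)).of_eq fun _ => ?_
    exact or_iff_not_imp_left
  have hsucc : PrimrecRel fun (i : ℕ) (r : ℕ × ℕ × List ℕ × ℕ) =>
      ∀ j < r.2.1, Nat.pair i j ∉ r.2.2.1 → r.1.testBit j :=
    hedge.forall_lt_of_param.comp (Primrec.fst.comp <| Primrec.snd.comp Primrec.snd) Primrec.id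
  have hclosed : PrimrecRel fun (i : ℕ) (r : ℕ × ℕ × List ℕ × ℕ) =>
      r.1.testBit i → ∀ j < r.2.1, Nat.pair i j ∉ r.2.2.1 → r.1.testBit j :=
    ((primrecRel_testBit.comp (Primrec.fst.comp Primrec.snd) Primrec.fst).not.or hsucc).of_eq
      fun _ => imp_iff_not_or.symm
  have hseparator : PrimrecRel fun (S : ℕ) (t : ℕ × List ℕ × ℕ) =>
      (∀ j < t.1, Nat.pair t.2.2 j ∉ t.2.1 → S.testBit j) ∧
      (∀ i < t.1, S.testBit i → ∀ j < t.1, Nat.pair i j ∉ t.2.1 → S.testBit j) ∧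
      ¬ S.testBit t.2.2 :=
    have hletter : Primrec fun q : ℕ × ℕ × List ℕ × ℕ => q.2.2.2 :=
      Primrec.snd.comp <| Primrec.snd.comp Primrec.snd
    (hsucc.comp hletter Primrec.id).and <|
    (hclosed.forall_lt_of_param.comp (Primrec.fst.comp Primrec.snd) Primrec.id).and
    (primrecRel_testBit.comp Primrec.fst hletter).not
  exact (hseparator.exists_lt_of_param.comp (primrec_two_pow.comp Primrec.fst) Primrec.id).not

end RDPZInstance

/-- The recurring domino problem on `ℤ` is decidable. -/
theorem rdp_Z_computablePred :
    ComputablePred (fun I : RDPZInstance =>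
      ∃ x : ℤ → Fin I.1,
        (∀ n : ℤ, (x n, x (n + 1)) ∉ I.2.1) ∧ {n : ℤ | x n = I.2.2}.Infinite) := by
  have h : ComputablePred fun I : RDPZInstance => RDPZInstance.NoSeparator I.numerals := by
    obtain ⟨_, hdec⟩ := RDPZInstance.primrecPred_noSeparator
    exact ⟨fun _ => inferInstance, hdec.to_comp.comp RDPZInstance.computable_numerals⟩
  refine h.of_eq fun I => ?_
  rw [RDPZInstance.noSeparator_numerals_iff, ← exists_recurrent_walk_iff_transGen]
end

section
/- Let G be a group and let σ₁ : Fin k₁ → G and σ₂ : Fin k₂ → G be two families with Subgroup.closure (Set.range σ₁) = ⊤ and Subgroup.closure (Set.range σ₂) = ⊤. Then the seeded domino problem SDP(G,σ₁) is ComputablePred if and only if SDP(G,σ₂) is ComputablePred; in other words, the decidability of the seeded domino problem on G does not depend on the chosen finite generating set. -/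
/-- An instance of the domino problems on a group with a generating family
indexed by `Fin k`: an alphabet size `m`, a finite set of forbidden
nearest-neighbour patterns, and a target letter `a₀ : Fin m`. -/
abbrev DomInstance (k : ℕ) : Type := Σ m : ℕ, Finset (Fin m × Fin m × Fin k) × Fin m

instance (k : ℕ) : Infinite (DomInstance k) :=
  Infinite.of_injective (fun n => (⟨n + 1, ∅, 0⟩ : DomInstance k)) fun a b h => by
    have : a + 1 = b + 1 := congrArg Sigma.fst h
    omega

noncomputable instance (k : ℕ) : Denumerable (DomInstance k) :=
  Denumerable.ofEncodableOfInfinite _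

/-- The seeded domino problem on `G` with respect to the generating family `σ`:
does some configuration avoiding the forbidden patterns place the target letter
at the identity? -/
def SDP (G : Type*) [Group G] {k : ℕ} (σ : Fin k → G) (I : DomInstance k) : Prop :=
  ∃ x : G → Fin I.1,
    (∀ (g : G) (i : Fin k), (x g, x (g * σ i), i) ∉ I.2.1) ∧ x 1 = I.2.2

open Encodable

namespace ComputablePred

variable {α β : Type*} [Primcodable α] [Primcodable β]

theorem comp {p : β → Prop} (hp : ComputablePred p) {f : α → β} (hf : Computable f) :
    ComputablePred fun a => p (f a) := by
  obtain ⟨_, hp⟩ := hp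
  exact ⟨inferInstance, hp.comp hf⟩

theorem const (p : Prop) : ComputablePred fun _ : α => p := by
  classical exact ⟨fun _ => inferInstance, Computable.const (decide p)⟩

theorem and {p q : α → Prop} (hp : ComputablePred p) (hq : ComputablePred q) :
    ComputablePred fun a => p a ∧ q a := by
  classical
  exact Computable.computablePred
    ((Primrec.and.to_comp.comp hp.decide hq.decide).of_eq fun a => by simp)

theorem or {p q : α → Prop} (hp : ComputablePred p) (hq : ComputablePred q) :
    ComputablePred fun a => p a ∨ q a :=
  (hp.not.and hq.not).not.of_eq fun a => by tauto

theorem imp {p q : α → Prop} (hp : ComputablePred p) (hq : ComputablePred q) :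
    ComputablePred fun a => p a → q a :=
  (hp.not.or hq).of_eq fun a => by tauto

theorem iff {p q : α → Prop} (hp : ComputablePred p) (hq : ComputablePred q) :
    ComputablePred fun a => p a ↔ q a :=
  ((hp.imp hq).and (hq.imp hp)).of_eq fun a => by tauto

theorem eq {f g : α → ℕ} (hf : Computable f) (hg : Computable g) :
    ComputablePred fun a => f a = g a :=
  (Primrec.eq (α := ℕ)).computablePred.comp (hf.pair hg)

theorem lt {f g : α → ℕ} (hf : Computable f) (hg : Computable g) :
    ComputablePred fun a => f a < g a :=
  Primrec.nat_lt.computablePred.comp (hf.pair hg)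

theorem forall_fin : ∀ {n : ℕ} {p : Fin n → α → Prop}, (∀ i, ComputablePred (p i)) →
    ComputablePred fun a => ∀ i, p i a
  | 0, _, _ => (const True).of_eq fun a => by simp
  | _ + 1, p, h => ((h 0).and (forall_fin fun i => h i.succ)).of_eq fun a =>
      (Fin.forall_fin_succ (P := fun i => p i a)).symm

theorem exists_fin {n : ℕ} {p : Fin n → α → Prop} (h : ∀ i, ComputablePred (p i)) :
    ComputablePred fun a => ∃ i, p i a :=
  (forall_fin fun i => (h i).not).not.of_eq fun a => by simp

theorem forall_lt {p : α × ℕ → Prop} (hp : ComputablePred p) {f : α → ℕ} (hf : Computable f) :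
    ComputablePred fun a => ∀ i < f a, p (a, i) := by
  obtain ⟨q, hq, rfl⟩ := computable_iff.1 hp
  have key : Computable fun a : α =>
      (Nat.rec true (fun n b => b && q (a, n)) (f a) : Bool) :=
    Computable.nat_rec (h := fun a (x : ℕ × Bool) => x.2 && q (a, x.1)) hf (Computable.const true)
      (Primrec.and.to_comp.comp (Computable.snd.comp Computable.snd)
        (hq.comp (Computable.fst.pair (Computable.fst.comp Computable.snd))))
  refine computable_iff.2 ⟨_, key, funext fun a => propext ?_⟩
  generalize f a = n
  induction n with
  | zero => simp
  | succ n ih => rw [Nat.forall_lt_succ_right, ih, Bool.and_eq_true]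

theorem exists_lt {p : α × ℕ → Prop} (hp : ComputablePred p) {f : α → ℕ} (hf : Computable f) :
    ComputablePred fun a => ∃ i < f a, p (a, i) :=
  (hp.not.forall_lt hf).not.of_eq fun a => by simp

theorem forall_mem_list {p : α × ℕ → Prop} (hp : ComputablePred p) {f : α → List ℕ}
    (hf : Computable f) : ComputablePred fun a => ∀ c ∈ f a, p (a, c) := by
  have h : ComputablePred fun x : α × ℕ => p (x.1, (f x.1).getD x.2 0) :=
    hp.comp (Computable.fst.pair
      ((Primrec.list_getD 0).to_comp.comp (hf.comp Computable.fst) Computable.snd))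
  refine (h.forall_lt (Computable.list_length.comp hf)).of_eq fun a => ?_
  simp only [List.forall_mem_iff_getElem]
  exact forall₂_congr fun i hi => by rw [List.getD_eq_getElem _ _ hi]

theorem mem_list {f : α → List ℕ} {g : α → ℕ} (hf : Computable f) (hg : Computable g) :
    ComputablePred fun a => g a ∈ f a :=
  (forall_mem_list (p := fun x => ¬ x.2 = g x.1)
    (eq Computable.snd (hg.comp Computable.fst)).not hf).not.of_eq fun a => by simp

theorem pairwise_lt {f : α → List ℕ} (hf : Computable f) :
    ComputablePred fun a => (f a).Pairwise (· < ·) := by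
  have get {β : Type _} [Primcodable β] {h : β → α} {i : β → ℕ} (hh : Computable h)
      (hi : Computable i) : Computable fun b => (f (h b)).getD (i b) 0 :=
    (Primrec.list_getD 0).to_comp.comp (hf.comp hh) hi
  have h : ComputablePred fun x : (α × ℕ) × ℕ =>
      (f x.1.1).getD x.2 0 < (f x.1.1).getD x.1.2 0 :=
    lt (get (Computable.fst.comp Computable.fst) Computable.snd)
      (get (Computable.fst.comp Computable.fst) (Computable.snd.comp Computable.fst))
  refine ((h.forall_lt Computable.snd).forall_lt (Computable.list_length.comp hf)).of_eq
    fun a => ?_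
  rw [List.pairwise_iff_getElem]
  constructor
  · intro H i j hi hj hij
    have := H j hj i hij
    rwa [List.getD_eq_getElem _ _ hi, List.getD_eq_getElem _ _ hj] at this
  · intro H j hj i hij
    have := H i j (hij.trans hj) hj hij
    rwa [← List.getD_eq_getElem _ 0 (hij.trans hj), ← List.getD_eq_getElem _ 0 hj] at this

end ComputablePred

theorem Nat.Subtype.computable_ofNat (s : Set ℕ) [DecidablePred (· ∈ s)] [Infinite s]
    (hs : ComputablePred (· ∈ s)) : Computable fun n => (Nat.Subtype.ofNat s n : ℕ) := by
  have hex : ∀ x : ℕ, ∃ n, x + n + 1 ∈ s := fun x => by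
    obtain ⟨y, hy, hxy⟩ := (Set.infinite_coe_iff.1 ‹Infinite s›).exists_gt x
    exact ⟨y - x - 1, by rwa [show x + (y - x - 1) + 1 = y by omega]⟩
  have hadd : Computable fun p : ℕ × ℕ => p.1 + p.2 + 1 :=
    Computable.succ.comp Primrec.nat_add.to_comp
  have hstep : Computable fun x : ℕ => x + Nat.find (hex x) + 1 :=
    hadd.comp (Computable.id.pair (Computable.find (hs.comp hadd) hex))
  refine (Computable.nat_rec (f := id) (g := fun _ => ((⊥ : s) : ℕ))
    (h := fun _ (x : ℕ × ℕ) => x.2 + Nat.find (hex x.2) + 1) Computable.id (Computable.const _)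
    (hstep.comp (Computable.snd.comp Computable.snd))).of_eq fun n => ?_
  induction n with
  | zero => rfl
  | succ n ih =>
    simp only [id] at ih ⊢
    rw [ih]
    rfl

/-- The numbering of `Denumerable.ofEncodableOfInfinite` lists the codes of the given encoding in
increasing order, so it computes these codes as soon as the set of codes is decidable. -/
theorem Denumerable.computable_encode_ofEncodableOfInfinite {α : Type*} [e : Encodable α]
    [Infinite α] (h : ComputablePred (· ∈ Set.range (@encode α e))) :
    @Computable α ℕ (@Primcodable.ofDenumerable α (ofEncodableOfInfinite α)) _ (@encode α e) := by
  let := @decidableRangeEncode α e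
  let : Infinite (Set.range (@encode α e)) :=
    Infinite.of_injective _ (Equiv.ofInjective _ encode_injective).injective
  have hn := Nat.Subtype.computable_ofNat _ h
  let d := ofEncodableOfInfinite α
  refine (hn.comp (@Computable.encode α (@Primcodable.ofDenumerable α d))).of_eq fun a => ?_
  obtain ⟨n, rfl⟩ : ∃ n, ofNat α n = a := ⟨_, ofNat_encode a⟩
  refine (congrArg (fun n => (Nat.Subtype.ofNat (Set.range (@encode α e)) n : ℕ))
    (encode_ofNat n)).trans ?_
  have : ofNat α n = (equivRangeEncode α).symm (Nat.Subtype.ofNat _ n) := rfl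
  rw [this]
  exact (congrArg Subtype.val ((equivRangeEncode α).apply_symm_apply _)).symm

theorem Finset.exists_list_encode {α : Type*} [Encodable α] (s : Finset α) :
    ∃ l : List α, (∀ a, a ∈ l ↔ a ∈ s) ∧ (l.map encode).Pairwise (· < ·) ∧
      encode s = encode (l.map encode) := by
  let r : α → α → Prop := encode ⁻¹'o (· ≤ ·)
  have : IsLinearOrder α r :=
    (RelEmbedding.preimage ⟨encode, encode_injective⟩ (· ≤ ·)).isLinearOrder
  obtain ⟨_, he⟩ : ∃ _ : DecidableRel r, encode s = encode (s.val.sort r) := ⟨_, rfl⟩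
  have hs := s.val.pairwise_sort r
  have hl := s.val.sort_eq r
  have hn : (s.val.sort r).Nodup := by
    rw [← Multiset.coe_nodup, hl]; exact s.nodup
  refine ⟨s.val.sort r, fun a => by simp, ?_, ?_⟩
  · rw [List.pairwise_map]
    exact (hs.and hn).imp fun h => lt_of_le_of_ne h.1 fun h' => h.2 (encode_injective h')
  · rw [he]
    induction s.val.sort r with
    | nil => rfl
    | cons a l ih => simp [ih]

theorem Finset.encode_eq_encode_map {α : Type*} [Encodable α] (s : Finset α) (l : List α)
    (h : ∀ a, a ∈ l ↔ a ∈ s) (hl : (l.map encode).Pairwise (· < ·)) :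
    encode s = encode (l.map encode) := by
  obtain ⟨l', h', hl', he⟩ := s.exists_list_encode
  rw [he]
  congr 1
  refine List.Perm.eq_of_pairwise' (r := (· < ·)) hl' hl ?_
  refine (List.perm_ext_iff_of_nodup (hl'.imp ne_of_lt) (hl.imp ne_of_lt)).2 fun c => ?_
  simp [h, h']

namespace DomInstance

open Nat (pair unpair)

variable {k : ℕ}

/-- The code of an instance from which the numbering of `DomInstance k` is built. -/
def code (I : DomInstance k) : ℕ := pair I.1 (pair (encode I.2.1) I.2.2)

/-- The increasing list of the codes of the forbidden patterns of an instance. -/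
def patternCodes (I : DomInstance k) : List ℕ := Denumerable.ofNat (List ℕ) (encode I.2.1)

/-- Forbidden patterns, with letters and generators given by their numbers. -/
def Forbids (I : DomInstance k) (a b i : ℕ) : Prop := pair a (pair b i) ∈ I.patternCodes

theorem encode_pattern {m : ℕ} (c : Fin m × Fin m × Fin k) :
    encode c = pair c.1 (pair c.2.1 c.2.2) := rfl

theorem forbids_iff (I : DomInstance k) (a b : Fin I.1) (i : Fin k) :
    I.Forbids a b i ↔ (a, b, i) ∈ I.2.1 := by
  obtain ⟨l, hl, -, he⟩ := I.2.1.exists_list_encode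
  rw [Forbids, patternCodes, he, Denumerable.ofNat_encode, ← hl]
  exact List.mem_map_of_injective encode_injective (a := (a, b, i))

/-- The codes of instances are the triples of a size, an increasing list of pattern codes and a
seed, all within bounds. -/
theorem mem_range_code_iff (n : ℕ) : n ∈ Set.range (code (k := k)) ↔
    n.unpair.2.unpair.2 < n.unpair.1 ∧
    (Denumerable.ofNat (List ℕ) n.unpair.2.unpair.1).Pairwise (· < ·) ∧
    ∀ c ∈ Denumerable.ofNat (List ℕ) n.unpair.2.unpair.1,
      c.unpair.1 < n.unpair.1 ∧ c.unpair.2.unpair.1 < n.unpair.1 ∧ c.unpair.2.unpair.2 < k := by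
  constructor
  · rintro ⟨I, rfl⟩
    obtain ⟨l, -, hl, he⟩ := I.2.1.exists_list_encode
    simp only [code, Nat.unpair_pair, he, Denumerable.ofNat_encode]
    refine ⟨I.2.2.isLt, hl, ?_⟩
    simp only [List.mem_map]
    rintro _ ⟨c, -, rfl⟩
    simp [encode_pattern]
  · rintro ⟨ha, hs, hb⟩
    obtain ⟨m, r, rfl⟩ : ∃ m r, pair m r = n := ⟨_, _, Nat.pair_unpair n⟩
    obtain ⟨e, a, rfl⟩ : ∃ e a, pair e a = r := ⟨_, _, Nat.pair_unpair r⟩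
    simp only [Nat.unpair_pair] at ha hs hb
    obtain ⟨L, rfl⟩ : ∃ L : List ℕ, encode L = e := ⟨_, Denumerable.encode_ofNat e⟩
    rw [Denumerable.ofNat_encode] at hs hb
    obtain ⟨l, rfl⟩ : ∃ l : List (Fin m × Fin m × Fin k), l.map encode = L := by
      have : L ∈ Set.range (List.map (encode (α := Fin m × Fin m × Fin k))) := by
        rw [Set.range_list_map]
        intro c hc
        obtain ⟨h1, h2, h3⟩ := hb c hc
        exact ⟨(⟨_, h1⟩, ⟨_, h2⟩, ⟨_, h3⟩), by
          rw [encode_pattern, Nat.pair_unpair, Nat.pair_unpair]⟩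
      exact this
    refine ⟨⟨m, l.toFinset, a, ha⟩, ?_⟩
    simp only [code]
    rw [Finset.encode_eq_encode_map _ l (by simp) hs]

theorem computablePred_mem_range_code : ComputablePred (· ∈ Set.range (code (k := k))) := by
  have hp {α : Type} [Primcodable α] {f : α → ℕ} (hf : Computable f) :
      (Computable fun a => (f a).unpair.1) ∧ Computable fun a => (f a).unpair.2 :=
    ⟨Computable.fst.comp (Computable.unpair.comp hf),
      Computable.snd.comp (Computable.unpair.comp hf)⟩
  have h1 := (hp Computable.id).1
  have h2 := (hp (hp Computable.id).2).1
  have h3 := (hp (hp Computable.id).2).2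
  have hl : Computable fun n : ℕ => Denumerable.ofNat (List ℕ) n.unpair.2.unpair.1 :=
    (Computable.ofNat _).comp h2
  have hm := h1.comp (Computable.fst (α := ℕ) (β := ℕ))
  have hs : Computable (Prod.snd : ℕ × ℕ → ℕ) := Computable.snd
  refine ((ComputablePred.lt h3 h1).and ((ComputablePred.pairwise_lt hl).and
    (((ComputablePred.lt (hp hs).1 hm).and ((ComputablePred.lt (hp (hp hs).2).1 hm).and
      (ComputablePred.lt (hp (hp hs).2).2 (Computable.const k)))).forall_mem_list hl))).of_eq
        fun n => (mem_range_code_iff n).symm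

theorem computable_code : Computable (code (k := k)) :=
  Denumerable.computable_encode_ofEncodableOfInfinite (α := DomInstance k)
    (e := Sigma.encodable) computablePred_mem_range_code

theorem computable_size : Computable fun I : DomInstance k => I.1 :=
  (Computable.fst.comp (Computable.unpair.comp computable_code)).of_eq fun I => by simp [code]

theorem computable_seed : Computable fun I : DomInstance k => (I.2.2 : ℕ) :=
  (Computable.snd.comp (Computable.unpair.comp (Computable.snd.comp
    (Computable.unpair.comp computable_code)))).of_eq fun I => by simp [code]

theorem computable_patternCodes : Computable (patternCodes (k := k)) :=
  ((Computable.ofNat (List ℕ)).comp (Computable.fst.comp (Computable.unpair.comp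
    (Computable.snd.comp (Computable.unpair.comp computable_code))))).of_eq
      fun I => by simp [code, patternCodes]

theorem computablePred_forbids {α : Type*} [Primcodable α] {I : α → DomInstance k}
    {a b i : α → ℕ} (hI : Computable I) (ha : Computable a) (hb : Computable b)
    (hi : Computable i) : ComputablePred fun x => (I x).Forbids (a x) (b x) (i x) :=
  ComputablePred.mem_list (computable_patternCodes.comp hI)
    (Primrec₂.natPair.to_comp.comp ha (Primrec₂.natPair.to_comp.comp hb hi))

end DomInstance

/-- The digit of `a` at position `u` in base `m`. -/
def digit (m a u : ℕ) : ℕ := a / m ^ u % m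

theorem finFunctionFinEquiv_symm_val {m K : ℕ} (a : Fin (m ^ K)) (u : Fin K) :
    (finFunctionFinEquiv.symm a u : ℕ) = digit m a u := rfl

theorem computable₂_natPow : Computable₂ fun a b : ℕ => a ^ b :=
  (Primrec₂.unpaired'.1 Nat.Primrec.pow).to_comp

theorem computable_digit {α : Type*} [Primcodable α] {m a : α → ℕ} (hm : Computable m)
    (ha : Computable a) (u : ℕ) : Computable fun x => digit (m x) (a x) u :=
  Primrec.nat_mod.to_comp.comp
    (Primrec.nat_div.to_comp.comp ha (computable₂_natPow.comp hm (Computable.const u))) hm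

section Recoding

variable {G : Type*} [Group G] {k₁ k₂ K : ℕ}

/-- The letter `a` of the recoded alphabet contains a pattern forbidden by `I`, where position `o`
stands for the identity and position `e i` for the generator `i`. -/
def LetterForbidden (o : Fin K) (e : Fin k₁ → Fin K) (I : DomInstance k₁) (a : ℕ) : Prop :=
  ∃ i : Fin k₁, I.Forbids (digit I.1 a o) (digit I.1 a (e i)) i

/-- The recoded letters `a` and `b`, placed along the generator `t`, disagree at a group element
that both of them describe. -/
def Inconsistent (σ : Fin k₂ → G) (p : Fin K → G) (I : DomInstance k₁) (a b t : ℕ) : Prop :=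
  ∃ (u v : Fin K) (s : Fin k₂), p u = σ s * p v ∧ t = s ∧ digit I.1 a u ≠ digit I.1 b v

/-- `J` is the instance over `σ` whose letters are the patterns of shape `p` over the alphabet of
`I`, with target letter `c`. -/
def IsRecoding (σ : Fin k₂ → G) (p : Fin K → G) (o : Fin K) (e : Fin k₁ → Fin K)
    (I : DomInstance k₁) (c : ℕ) (J : DomInstance k₂) : Prop :=
  J.1 = I.1 ^ K ∧ (J.2.2 : ℕ) = c ∧ ∀ a < I.1 ^ K, ∀ b < I.1 ^ K, ∀ t < k₂,
    J.Forbids a b t ↔ LetterForbidden o e I a ∨ Inconsistent σ p I a b t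

theorem computablePred_letterForbidden (o : Fin K) (e : Fin k₁ → Fin K) {α : Type*}
    [Primcodable α] {I : α → DomInstance k₁} {a : α → ℕ} (hI : Computable I)
    (ha : Computable a) : ComputablePred fun x => LetterForbidden o e (I x) (a x) :=
  ComputablePred.exists_fin fun _ => DomInstance.computablePred_forbids hI
    (computable_digit (DomInstance.computable_size.comp hI) ha _)
    (computable_digit (DomInstance.computable_size.comp hI) ha _) (Computable.const _)

theorem computablePred_inconsistent (σ : Fin k₂ → G) (p : Fin K → G) {α : Type*}
    [Primcodable α] {I : α → DomInstance k₁} {a b t : α → ℕ} (hI : Computable I)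
    (ha : Computable a) (hb : Computable b) (ht : Computable t) :
    ComputablePred fun x => Inconsistent σ p (I x) (a x) (b x) (t x) :=
  ComputablePred.exists_fin fun _ => ComputablePred.exists_fin fun _ =>
    ComputablePred.exists_fin fun s => (ComputablePred.const _).and
      ((ComputablePred.eq ht (Computable.const s.val)).and
        (ComputablePred.eq (computable_digit (DomInstance.computable_size.comp hI) ha _)
          (computable_digit (DomInstance.computable_size.comp hI) hb _)).not)

theorem computable_pow_size (K : ℕ) : Computable fun I : DomInstance k₁ => I.1 ^ K :=
  computable₂_natPow.comp DomInstance.computable_size (Computable.const K)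

theorem computablePred_isRecoding (σ : Fin k₂ → G) (p : Fin K → G) (o : Fin K)
    (e : Fin k₁ → Fin K) : ComputablePred fun x : (DomInstance k₁ × ℕ) × DomInstance k₂ =>
      IsRecoding σ p o e x.1.1 x.1.2 x.2 := by
  have hI : Computable fun x : (((DomInstance k₁ × ℕ) × DomInstance k₂) × ℕ) × ℕ => x.1.1.1.1 :=
    Computable.fst.comp (Computable.fst.comp (Computable.fst.comp Computable.fst))
  have hJ : Computable fun x : (((DomInstance k₁ × ℕ) × DomInstance k₂) × ℕ) × ℕ => x.1.1.2 :=
    Computable.snd.comp (Computable.fst.comp Computable.fst)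
  have hsize : Computable fun x : (DomInstance k₁ × ℕ) × DomInstance k₂ => x.1.1.1 ^ K :=
    (computable_pow_size K).comp (Computable.fst.comp Computable.fst)
  have h4 {β : Type} [Primcodable β] : Computable fun x : (β × ℕ) × ℕ => x.1.2 :=
    Computable.snd.comp Computable.fst
  refine (ComputablePred.eq (DomInstance.computable_size.comp Computable.snd) hsize).and
    ((ComputablePred.eq (DomInstance.computable_seed.comp Computable.snd)
      (Computable.snd.comp Computable.fst)).and ?_)
  refine ComputablePred.forall_lt (p := fun x : ((DomInstance k₁ × ℕ) × DomInstance k₂) × ℕ =>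
      ∀ b < x.1.1.1.1 ^ K, ∀ t < k₂,
    x.1.2.Forbids x.2 b t ↔ LetterForbidden o e x.1.1.1 x.2 ∨ Inconsistent σ p x.1.1.1 x.2 b t)
    ?_ hsize
  refine ComputablePred.forall_lt (p := fun x : (((DomInstance k₁ × ℕ) × DomInstance k₂) × ℕ) × ℕ =>
      ∀ t < k₂, x.1.1.2.Forbids x.1.2 x.2 t ↔
      LetterForbidden o e x.1.1.1.1 x.1.2 ∨ Inconsistent σ p x.1.1.1.1 x.1.2 x.2 t)
    ?_ (hsize.comp Computable.fst)
  have hI' := hI.comp (Computable.fst (β := ℕ))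
  have ha := h4.comp (Computable.fst (α := (((DomInstance k₁ × ℕ) × DomInstance k₂) × ℕ) × ℕ)
    (β := ℕ))
  refine ComputablePred.forall_lt
    (p := fun x : ((((DomInstance k₁ × ℕ) × DomInstance k₂) × ℕ) × ℕ) × ℕ =>
      x.1.1.1.2.Forbids x.1.1.2 x.1.2 x.2 ↔
      LetterForbidden o e x.1.1.1.1.1 x.1.1.2 ∨
        Inconsistent σ p x.1.1.1.1.1 x.1.1.2 x.1.2 x.2) ?_ (Computable.const k₂)
  exact (DomInstance.computablePred_forbids (hJ.comp Computable.fst) ha h4 Computable.snd).iff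
    ((computablePred_letterForbidden o e hI' ha).or
      (computablePred_inconsistent σ p hI' ha h4 Computable.snd))

theorem exists_isRecoding (σ : Fin k₂ → G) (p : Fin K → G) (o : Fin K) (e : Fin k₁ → Fin K)
    (I : DomInstance k₁) (c : ℕ) (hc : c < I.1 ^ K) : ∃ J, IsRecoding σ p o e I c J := by
  classical
  let J : DomInstance k₂ := ⟨I.1 ^ K, Finset.univ.filter fun x =>
      LetterForbidden o e I x.1 ∨ Inconsistent σ p I x.1 x.2.1 x.2.2, ⟨c, hc⟩⟩
  refine ⟨J, rfl, rfl, fun a ha b hb t ht => ?_⟩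
  refine (J.forbids_iff ⟨a, ha⟩ ⟨b, hb⟩ ⟨t, ht⟩).trans ?_
  simp [J]

variable {σ₁ : Fin k₁ → G} {σ₂ : Fin k₂ → G} {p : Fin K → G} {o : Fin K} {e : Fin k₁ → Fin K}
  {I : DomInstance k₁}

theorem SDP.exists_recoding (ho : p o = 1) (he : ∀ i, p (e i) = σ₁ i) (h : SDP G σ₁ I) :
    ∃ c < I.1 ^ K, digit I.1 c o = I.2.2 ∧ ¬ LetterForbidden o e I c ∧
      ∀ J, IsRecoding σ₂ p o e I c J → SDP G σ₂ J := by
  obtain ⟨x, hx, hx1⟩ := h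
  let y : G → Fin (I.1 ^ K) := fun g => finFunctionFinEquiv fun u => x (g * p u)
  have hy (g : G) (u : Fin K) : digit I.1 (y g) u = x (g * p u) := by
    rw [← finFunctionFinEquiv_symm_val, Equiv.symm_apply_apply]
  have hL (g : G) : ¬ LetterForbidden o e I (y g) := by
    rintro ⟨i, hi⟩
    rw [hy, hy, ho, he, mul_one, I.forbids_iff] at hi
    exact hx g i hi
  refine ⟨y 1, (y 1).isLt, by rw [hy, ho, mul_one, hx1], hL 1, ?_⟩
  rintro ⟨m, F, c⟩ ⟨hm, hc, hF⟩
  dsimp only at hm hc hF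
  subst hm
  refine ⟨y, fun g t ht => ?_, (Fin.ext hc).symm⟩
  rcases (hF _ (y g).isLt _ (y (g * σ₂ t)).isLt _ t.isLt).1
    ((DomInstance.forbids_iff ⟨_, F, c⟩ (y g) (y (g * σ₂ t)) t).2 ht) with h | ⟨u, v, s, huv, hts, h⟩
  · exact hL g h
  · obtain rfl : t = s := Fin.ext hts
    rw [hy, hy, huv, mul_assoc] at h
    exact h rfl

theorem SDP.of_recoding (hσ : Subgroup.closure (Set.range σ₂) = ⊤) (ho : p o = 1)
    (he : ∀ i, p (e i) = σ₁ i)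
    (hconn : ∀ Q : Fin K → Prop, Q o →
      (∀ u v t, p u = σ₂ t * p v → (Q u ↔ Q v)) → ∀ u, Q u)
    {c : ℕ} (hc : digit I.1 c o = I.2.2) (hL : ¬ LetterForbidden o e I c)
    {J : DomInstance k₂} (hJ : IsRecoding σ₂ p o e I c J) (h : SDP G σ₂ J) : SDP G σ₁ I := by
  obtain ⟨m, F, c'⟩ := J
  obtain ⟨hm, rfl, hF⟩ := hJ
  obtain ⟨y, hy, hy1⟩ := h
  dsimp only at hm hc hL hF y hy hy1
  subst hm
  have hgood (g : G) (t : Fin k₂) :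
      ¬ (LetterForbidden o e I (y g) ∨ Inconsistent σ₂ p I (y g) (y (g * σ₂ t)) t) := fun h =>
    hy g t ((DomInstance.forbids_iff ⟨_, F, c'⟩ (y g) (y (g * σ₂ t)) t).1
      ((hF _ (y g).isLt _ (y (g * σ₂ t)).isLt _ t.isLt).2 h))
  have hletter (g : G) : ¬ LetterForbidden o e I (y g) := by
    rcases k₂.eq_zero_or_pos with rfl | hk
    · have hg : g ∈ Subgroup.closure (Set.range σ₂) := hσ ▸ Subgroup.mem_top g
      rw [Set.range_eq_empty, Subgroup.closure_empty, Subgroup.mem_bot] at hg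
      rwa [hg, hy1]
    · exact fun h => hgood g ⟨0, hk⟩ (Or.inl h)
  let x : G → Fin I.1 := fun g => finFunctionFinEquiv.symm (y g) o
  have hx (u : Fin K) : ∀ g, digit I.1 (y g) u = x (g * p u) := by
    refine hconn (fun u => ∀ g, digit I.1 (y g) u = x (g * p u)) (fun g => ?_)
      (fun u v t huv => ?_) u
    · rw [ho, mul_one]; rfl
    · have hedge (g : G) : digit I.1 (y g) u = digit I.1 (y (g * σ₂ t)) v := by
        by_contra hne
        exact hgood g t (Or.inr ⟨u, v, t, huv, rfl, hne⟩)
      constructor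
      · intro H g
        have h1 := hedge (g * (σ₂ t)⁻¹)
        rw [inv_mul_cancel_right] at h1
        rw [← h1, H, huv, mul_assoc, inv_mul_cancel_left]
      · intro H g
        rw [hedge, H, huv, mul_assoc]
  refine ⟨x, fun g i hi => hletter g ⟨i, ?_⟩, Fin.ext ?_⟩
  · rw [hx, hx, ho, he, mul_one, I.forbids_iff]
    exact hi
  · rw [← hc, ← hy1]; rfl

/-- Finitely many elements of a group lie in a finite set that is connected in the Cayley graph and
contains the identity. -/
theorem exists_connected_shape (hσ : Subgroup.closure (Set.range σ₂) = ⊤) (σ₁ : Fin k₁ → G) :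
    ∃ (K : ℕ) (p : Fin K → G) (o : Fin K) (e : Fin k₁ → Fin K), p o = 1 ∧
      (∀ i, p (e i) = σ₁ i) ∧ ∀ Q : Fin K → Prop, Q o →
        (∀ u v t, p u = σ₂ t * p v → (Q u ↔ Q v)) → ∀ u, Q u := by
  classical
  let Conn (S : Finset G) : Prop := ∀ Q : G → Prop, Q 1 →
    (∀ u ∈ S, ∀ v ∈ S, ∀ t, u = σ₂ t * v → (Q u ↔ Q v)) → ∀ u ∈ S, Q u
  have hex (g : G) : ∃ S, 1 ∈ S ∧ g ∈ S ∧ Conn S := by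
    have hg : g ∈ Subgroup.closure (Set.range σ₂) := hσ ▸ Subgroup.mem_top g
    induction hg using Subgroup.closure_induction_left with
    | one => exact ⟨{1}, by simp, by simp, fun Q h1 _ u hu => Finset.mem_singleton.1 hu ▸ h1⟩
    | mul_left x hx y _ ih =>
      obtain ⟨t, rfl⟩ := hx
      obtain ⟨S, h1, hy, hS⟩ := ih
      refine ⟨insert (σ₂ t * y) S, by simp [h1], by simp, fun Q hQ hE => ?_⟩
      have h := hS Q hQ fun u hu v hv =>
        hE u (Finset.mem_insert_of_mem hu) v (Finset.mem_insert_of_mem hv)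
      exact (Finset.forall_mem_insert ..).2
        ⟨(hE _ (by simp) y (by simp [hy]) t rfl).2 (h y hy), h⟩
    | inv_mul_cancel x hx y _ ih =>
      obtain ⟨t, rfl⟩ := hx
      obtain ⟨S, h1, hy, hS⟩ := ih
      refine ⟨insert ((σ₂ t)⁻¹ * y) S, by simp [h1], by simp, fun Q hQ hE => ?_⟩
      have h := hS Q hQ fun u hu v hv =>
        hE u (Finset.mem_insert_of_mem hu) v (Finset.mem_insert_of_mem hv)
      exact (Finset.forall_mem_insert ..).2
        ⟨(hE y (by simp [hy]) _ (by simp) t (by simp)).1 (h y hy), h⟩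
  choose S h1 hmem hconn using hex
  let T : Finset G := insert 1 (Finset.univ.biUnion fun i => S (σ₁ i))
  have hsub (i : Fin k₁) : S (σ₁ i) ⊆ T := fun g hg =>
    Finset.mem_insert_of_mem (Finset.mem_biUnion.2 ⟨i, Finset.mem_univ _, hg⟩)
  let E := T.equivFin
  refine ⟨T.card, fun u => (E.symm u : G), E ⟨1, by simp [T]⟩,
    fun i => E ⟨σ₁ i, hsub i (hmem _)⟩, by simp, by simp, fun Q hQ hE u => ?_⟩
  obtain ⟨⟨g, hg⟩, rfl⟩ := E.surjective u
  rcases Finset.mem_insert.1 hg with rfl | hg'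
  · exact hQ
  obtain ⟨i, -, hi⟩ := Finset.mem_biUnion.1 hg'
  refine hconn (σ₁ i) (fun g => ∀ hg : g ∈ T, Q (E ⟨g, hg⟩)) (fun _ => hQ)
    (fun u hu v hv t huv => ?_) g hi hg
  have := hE (E ⟨u, hsub i hu⟩) (E ⟨v, hsub i hv⟩) t (by simpa using huv)
  exact ⟨fun h _ => this.1 (h _), fun h _ => this.2 (h _)⟩

end Recoding

theorem ComputablePred.sdp_of_closure_eq_top {G : Type*} [Group G] {k₁ k₂ : ℕ}
    (σ₁ : Fin k₁ → G) (σ₂ : Fin k₂ → G) (hσ : Subgroup.closure (Set.range σ₂) = ⊤)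
    (h : ComputablePred (SDP G σ₂)) : ComputablePred (SDP G σ₁) := by
  classical
  obtain ⟨K, p, o, e, ho, he, hconn⟩ := exists_connected_shape hσ σ₁
  let P (x : DomInstance k₁ × ℕ) (n : ℕ) : Prop :=
    x.2 < x.1.1 ^ K → IsRecoding σ₂ p o e x.1 x.2 (Denumerable.ofNat (DomInstance k₂) n)
  have hex (x) : ∃ n, P x n := by
    by_cases hx : x.2 < x.1.1 ^ K
    · obtain ⟨J, hJ⟩ := exists_isRecoding σ₂ p o e x.1 x.2 hx
      exact ⟨@encode _ Denumerable.toEncodable J, fun _ => by rwa [Denumerable.ofNat_encode]⟩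
    · exact ⟨0, fun h => absurd h hx⟩
  have hlt : ComputablePred fun x : DomInstance k₁ × ℕ => x.2 < x.1.1 ^ K :=
    ComputablePred.lt Computable.snd ((computable_pow_size K).comp Computable.fst)
  have hP : ComputablePred fun x : (DomInstance k₁ × ℕ) × ℕ => P x.1 x.2 :=
    (hlt.comp Computable.fst).imp ((computablePred_isRecoding σ₂ p o e).comp
      (Computable.fst.pair ((Computable.ofNat _).comp Computable.snd)))
  let J (x : DomInstance k₁ × ℕ) : DomInstance k₂ := Denumerable.ofNat _ (Nat.find (hex x))
  have hJ : Computable J := (Computable.ofNat _).comp (Computable.find hP hex)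
  have hJspec (x : DomInstance k₁ × ℕ) (hx : x.2 < x.1.1 ^ K) :
      IsRecoding σ₂ p o e x.1 x.2 (J x) := Nat.find_spec (hex x) hx
  refine (((ComputablePred.eq (computable_digit (DomInstance.computable_size.comp Computable.fst)
    Computable.snd o) (DomInstance.computable_seed.comp Computable.fst)).and
      ((computablePred_letterForbidden o e Computable.fst Computable.snd).not.and
        (h.comp hJ))).exists_lt (computable_pow_size K)).of_eq fun I => ?_
  constructor
  · rintro ⟨c, hcK, hc, hL, hs⟩
    exact hs.of_recoding hσ ho he hconn hc hL (hJspec (I, c) hcK)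
  · intro hs
    obtain ⟨c, hcK, hc, hL, H⟩ := hs.exists_recoding (σ₂ := σ₂) ho he
    exact ⟨c, hcK, hc, hL, H _ (hJspec (I, c) hcK)⟩

/-- The decidability of the seeded domino problem does not depend on the chosen
finite generating set. -/
theorem sdp_computablePred_iff_of_closure_eq_top {G : Type*} [Group G]
    {k₁ k₂ : ℕ} (σ₁ : Fin k₁ → G) (σ₂ : Fin k₂ → G)
    (h₁ : Subgroup.closure (Set.range σ₁) = ⊤)
    (h₂ : Subgroup.closure (Set.range σ₂) = ⊤) :
    ComputablePred (SDP G σ₁) ↔ ComputablePred (SDP G σ₂) :=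
  ⟨ComputablePred.sdp_of_closure_eq_top σ₂ σ₁ h₁, ComputablePred.sdp_of_closure_eq_top σ₁ σ₂ h₂⟩
end

section
/- Let G be a group and let σ₁ : Fin k₁ → G and σ₂ : Fin k₂ → G be two families with Subgroup.closure (Set.range σ₁) = ⊤ and Subgroup.closure (Set.range σ₂) = ⊤. Then the recurring domino problem RDP(G,σ₁) is ComputablePred if and only if RDP(G,σ₂) is ComputablePred; in other words, the decidability of the recurring domino problem on G does not depend on the chosen finite generating set. -/
/-- The recurring domino problem on `G` with respect to the generating family `σ`:
does some configuration avoiding the forbidden patterns contain the target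
letter infinitely often? -/
def RDP (G : Type*) [Group G] {k : ℕ} (σ : Fin k → G) (I : DomInstance k) : Prop :=
  ∃ x : G → Fin I.1,
    (∀ (g : G) (i : Fin k), (x g, x (g * σ i), i) ∉ I.2.1) ∧
    {g : G | x g = I.2.2}.Infinite

open Encodable

/-- If the codes of `α` form a primitive recursive set, passing from the denumeration of `α`
by increasing codes back to the codes is computable. -/
theorem computable_encode_ofEncodableOfInfinite {α : Type*} [E : Encodable α] [Infinite α]
    (h : PrimrecPred fun n => n ∈ Set.range (encode : α → ℕ)) :
    Computable fun n => E.encode (@Denumerable.ofNat α (Denumerable.ofEncodableOfInfinite α) n) := by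
  let := @decidableRangeEncode α _
  have hinf : (Set.range (encode : α → ℕ)).Infinite :=
    Set.infinite_range_of_injective encode_injective
  have hex (x : ℕ) : ∃ n, x + n + 1 ∈ Set.range (encode : α → ℕ) := by
    obtain ⟨b, hb, hlt⟩ := hinf.exists_gt x
    exact ⟨b - x - 1, by rwa [show x + (b - x - 1) + 1 = b by omega]⟩
  have hfind : Computable fun x => Nat.find (hex x) :=
    Computable.find (P := fun x n => x + n + 1 ∈ Set.range (encode : α → ℕ))
      (h.comp (Primrec.succ.comp Primrec.nat_add)).computablePred hex
  have : Infinite (Set.range (encode : α → ℕ)) := hinf.to_subtype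
  have key (n : ℕ) : E.encode (@Denumerable.ofNat α (Denumerable.ofEncodableOfInfinite α) n) =
      Nat.Subtype.ofNat (Set.range (encode : α → ℕ)) n := by
    let := Nat.Subtype.denumerable (Set.range (encode : α → ℕ))
    have : @Denumerable.ofNat α (Denumerable.ofEncodableOfInfinite α) n =
        (equivRangeEncode α).symm (Nat.Subtype.ofNat (Set.range (encode : α → ℕ)) n) :=
      (Denumerable.ofEquiv_ofNat _ (equivRangeEncode α) n).trans rfl
    rw [this]
    exact congrArg Subtype.val ((equivRangeEncode α).apply_symm_apply _)
  have hstep : Computable fun x => x + Nat.find (hex x) + 1 :=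
    Computable.succ.comp (Primrec.nat_add.to_comp.comp Computable.id hfind)
  have hrec : Computable fun n : ℕ => (Nat.rec
      ((⊥ : Set.range (encode : α → ℕ)) : ℕ) (fun _ x => x + Nat.find (hex x) + 1) n : ℕ) :=
    Computable.nat_rec Computable.id (Computable.const _)
      (hstep.comp (Computable.snd.comp Computable.snd)).to₂
  refine hrec.of_eq fun n => ?_
  rw [key]
  induction n with
  | zero => rfl
  | succ n ih =>
    simp only [ih, Nat.Subtype.ofNat, Nat.Subtype.succ]

theorem PrimrecPred.forall_mem_comp {α β : Type*} [Primcodable α] [Primcodable β]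
    {l : α → List β} {p : α → β → Prop} (hp : PrimrecPred fun x : α × β => p x.1 x.2)
    (hl : Primrec l) : PrimrecPred fun a => ∀ b ∈ l a, p a b := by
  have hp' : PrimrecRel fun b a => p a b := hp.comp (Primrec.snd.pair Primrec.fst)
  exact hp'.forall_mem_list.comp hl Primrec.id

theorem PrimrecPred.forall_lt_comp {α : Type*} [Primcodable α] {f : α → ℕ} {p : α → ℕ → Prop}
    (hp : PrimrecPred fun x : α × ℕ => p x.1 x.2) (hf : Primrec f) :
    PrimrecPred fun a => ∀ n < f a, p a n :=
  (hp.forall_mem_comp (Primrec.list_range.comp hf)).of_eq fun _ => by simp only [List.mem_range]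

namespace DomInstance

variable {k : ℕ}

/-- The alphabet size, the increasing list of codes of the forbidden patterns and the target
letter of an instance. -/
def toRaw (I : DomInstance k) : ℕ × List ℕ × ℕ :=
  (I.1, (I.2.1.val.map encode).sort (· ≤ ·), I.2.2)

theorem encode_toRaw (I : DomInstance k) : encode I.toRaw = Sigma.encodable.encode I := by
  obtain ⟨m, F, a⟩ := I
  have h : encode F = encode ((F.val.map encode).sort (· ≤ ·)) := by
    have hlist (l : List (Fin m × Fin m × Fin k)) : encode l = encode (l.map encode) := by
      induction l with
      | nil => rfl
      | cons a l ih => simp [ih]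
    have := (RelEmbedding.preimage ⟨encode, encode_injective (α := Fin m × Fin m × Fin k)⟩
      (· ≤ ·)).isLinearOrder
    have hsort : (F.val.sort (encode ⁻¹'o (· ≤ ·))).map encode =
        (F.val.map encode).sort (· ≤ ·) :=
      Multiset.map_sort _ _ _ _ fun _ _ _ _ => Iff.rfl
    rw [← hsort, ← hlist]
    rfl
  simp only [toRaw, encode_prod_val, ← h]
  rfl

theorem mem_toRaw {I : DomInstance k} (i j : Fin I.1) (c : Fin k) :
    Nat.pair i (Nat.pair j c) ∈ I.toRaw.2.1 ↔ (i, j, c) ∈ I.2.1 := by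
  have : Nat.pair i (Nat.pair j c) = encode (i, j, c) := rfl
  simp only [toRaw, Multiset.mem_sort, this, Multiset.mem_map_of_injective encode_injective,
    Finset.mem_val]

theorem mem_range_toRaw {x : ℕ × List ℕ × ℕ} :
    x ∈ Set.range (toRaw (k := k)) ↔ x.2.2 < x.1 ∧ x.2.1.Pairwise (· < ·) ∧
      ∀ z ∈ x.2.1, z.unpair.1 < x.1 ∧ z.unpair.2.unpair.1 < x.1 ∧ z.unpair.2.unpair.2 < k := by
  constructor
  · rintro ⟨I, rfl⟩
    refine ⟨I.2.2.2, ?_, fun z hz => ?_⟩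
    · have h1 := Multiset.pairwise_sort (I.2.1.val.map encode) (· ≤ ·)
      have h2 : ((I.2.1.val.map encode).sort (· ≤ ·)).Nodup := by
        rw [← Multiset.coe_nodup, Multiset.sort_eq]
        exact I.2.1.nodup.map encode_injective
      exact (h1.and h2).imp fun h => lt_of_le_of_ne h.1 h.2
    · obtain ⟨⟨i, j, c⟩, -, rfl⟩ := Multiset.mem_map.1 ((Multiset.mem_sort _).1 hz)
      have : encode (i, j, c) = Nat.pair i (Nat.pair j c) := rfl
      simp [this, toRaw]
  · obtain ⟨m, L, a⟩ := x
    rintro ⟨ha, hs, hL⟩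
    classical
    refine ⟨⟨m, Finset.univ.filter fun p => encode p ∈ L, ⟨a, ha⟩⟩, ?_⟩
    simp only [toRaw, Prod.mk.injEq, and_true, true_and]
    have hn : (Multiset.ofList L).Nodup := Multiset.coe_nodup.2 (hs.imp fun h => h.ne)
    have : (Finset.univ.filter fun p : Fin m × Fin m × Fin k => encode p ∈ L).val.map encode
        = (L : Multiset ℕ) := by
      refine (Multiset.Nodup.ext ((Finset.nodup _).map encode_injective) hn).2 fun z => ?_
      simp only [Multiset.mem_map, Finset.mem_val, Finset.mem_filter, Finset.mem_univ, true_and,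
        Multiset.mem_coe]
      constructor
      · rintro ⟨p, hp, rfl⟩
        exact hp
      · intro hz
        obtain ⟨h1, h2, h3⟩ := hL z hz
        have h : encode ((⟨_, h1⟩, ⟨_, h2⟩, ⟨_, h3⟩) : Fin m × Fin m × Fin k) = z :=
          (congrArg (Nat.pair _) (Nat.pair_unpair _)).trans (Nat.pair_unpair z)
        exact ⟨(⟨_, h1⟩, ⟨_, h2⟩, ⟨_, h3⟩), by rwa [h], h⟩
    rw [this, Multiset.coe_sort]
    exact List.mergeSort_eq_self _ (hs.imp fun h => by simpa using h.le)

theorem primrecPred_mem_range_toRaw : PrimrecPred (· ∈ Set.range (toRaw (k := k))) := by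
  have hpw : PrimrecPred fun L : List ℕ => L.Pairwise (· < ·) := by
    have hlt : PrimrecPred fun x : (List ℕ × ℕ) × ℕ =>
        x.2 < x.1.2 → x.1.1.getD x.2 0 < x.1.1.getD x.1.2 0 := by
      have hl : Primrec fun x : (List ℕ × ℕ) × ℕ => x.1.1 := Primrec.fst.comp Primrec.fst
      have hj : Primrec fun x : (List ℕ × ℕ) × ℕ => x.1.2 := Primrec.snd.comp Primrec.fst
      exact ((Primrec.nat_lt.comp Primrec.snd hj).not.or (Primrec.nat_lt.comp
        ((Primrec.list_getD 0).comp hl Primrec.snd) ((Primrec.list_getD 0).comp hl hj))).of_eq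
          fun _ => imp_iff_not_or.symm
    have hlen : PrimrecPred fun L : List ℕ =>
        ∀ j < L.length, ∀ i < L.length, i < j → L.getD i 0 < L.getD j 0 :=
      (hlt.forall_lt_comp (Primrec.list_length.comp Primrec.fst)).forall_lt_comp
        Primrec.list_length
    refine hlen.of_eq fun L => ?_
    rw [List.pairwise_iff_getElem]
    constructor
    · intro h i j hi hj hij
      simpa only [List.getD_eq_getElem _ _ hi, List.getD_eq_getElem _ _ hj] using h j hj i hi hij
    · intro h j hj i hi hij
      simpa only [List.getD_eq_getElem _ _ hi, List.getD_eq_getElem _ _ hj] using h i j hi hj hij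
  have hcode : PrimrecPred fun p : (ℕ × List ℕ × ℕ) × ℕ => p.2.unpair.1 < p.1.1 ∧
      p.2.unpair.2.unpair.1 < p.1.1 ∧ p.2.unpair.2.unpair.2 < k := by
    have hz : Primrec fun p : (ℕ × List ℕ × ℕ) × ℕ => p.2.unpair := Primrec.unpair.comp Primrec.snd
    have hz2 : Primrec fun p : (ℕ × List ℕ × ℕ) × ℕ => p.2.unpair.2.unpair :=
      Primrec.unpair.comp (Primrec.snd.comp hz)
    have hm : Primrec fun p : (ℕ × List ℕ × ℕ) × ℕ => p.1.1 := Primrec.fst.comp Primrec.fst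
    exact (Primrec.nat_lt.comp (Primrec.fst.comp hz) hm).and
      ((Primrec.nat_lt.comp (Primrec.fst.comp hz2) hm).and
        (Primrec.nat_lt.comp (Primrec.snd.comp hz2) (Primrec.const k)))
  have hl : Primrec fun x : ℕ × List ℕ × ℕ => x.2.1 := Primrec.fst.comp Primrec.snd
  have hall : PrimrecPred fun x : ℕ × List ℕ × ℕ => ∀ z ∈ x.2.1,
      z.unpair.1 < x.1 ∧ z.unpair.2.unpair.1 < x.1 ∧ z.unpair.2.unpair.2 < k :=
    PrimrecPred.forall_mem_comp hcode hl
  refine ((Primrec.nat_lt.comp (Primrec.snd.comp Primrec.snd) Primrec.fst).and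
    ((hpw.comp hl).and hall)).of_eq fun x => ?_
  exact mem_range_toRaw.symm

theorem primrecPred_mem_range_encode :
    PrimrecPred fun n => n ∈ Set.range (Sigma.encodable.encode : DomInstance k → ℕ) := by
  refine (primrecPred_mem_range_toRaw (k := k)).comp
    (Primrec.ofNat (ℕ × List ℕ × ℕ)) |>.of_eq fun n => ?_
  constructor
  · rintro ⟨I, hI⟩
    exact ⟨I, by rw [← encode_toRaw, hI, Denumerable.encode_ofNat]⟩
  · rintro ⟨I, rfl⟩
    exact ⟨I, by rw [← encode_toRaw, Denumerable.ofNat_encode]⟩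

theorem computable_toRaw : Computable (toRaw (k := k)) := by
  have h' := (computable_encode_ofEncodableOfInfinite (primrecPred_mem_range_encode (k := k)))
  have h'' := h'.comp (Computable.encode (α := DomInstance k))
  have := (Computable.ofNat (ℕ × List ℕ × ℕ)).comp h''
  refine this.of_eq fun I => ?_
  rw [← encode_toRaw, Denumerable.ofNat_encode]
  exact congrArg toRaw (Denumerable.ofNat_encode I)

end DomInstance

section Reduction

variable {G : Type*} [Group G] {k l : ℕ}

theorem exists_finset_forall_eq_mul_one {σ : Fin k → G} (h : Subgroup.closure (Set.range σ) = ⊤)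
    (s : G) : ∃ S : Finset G, ∀ S' : Finset G, S ⊆ S' → s ∈ S' ∧ ∀ y : G → G → ℕ,
      (∀ t ∈ S', ∀ c, σ c * t ∈ S' → ∀ g, y g (σ c * t) = y (g * σ c) t) →
        ∀ g, y g s = y (g * s) 1 := by
  classical
  have hs : s ∈ Subgroup.closure (Set.range σ) := h ▸ Subgroup.mem_top s
  induction hs using Subgroup.closure_induction_left with
  | one => exact ⟨{1}, fun S' hS => ⟨hS (by simp), fun y _ g => by simp⟩⟩
  | mul_left x hx t _ ih =>
    obtain ⟨c, rfl⟩ := hx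
    obtain ⟨S, hS⟩ := ih
    refine ⟨insert (σ c * t) S, fun S' hS' => ?_⟩
    obtain ⟨hmem, hsub⟩ := Finset.insert_subset_iff.1 hS'
    obtain ⟨ht, hy⟩ := hS S' hsub
    refine ⟨hmem, fun y hc g => ?_⟩
    rw [hc t ht c hmem, hy y hc, mul_assoc]
  | inv_mul_cancel x hx t _ ih =>
    obtain ⟨c, rfl⟩ := hx
    obtain ⟨S, hS⟩ := ih
    refine ⟨insert ((σ c)⁻¹ * t) S, fun S' hS' => ?_⟩
    obtain ⟨hmem, hsub⟩ := Finset.insert_subset_iff.1 hS'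
    obtain ⟨ht, hy⟩ := hS S' hsub
    refine ⟨hmem, fun y hc g => ?_⟩
    have := hc _ hmem c (by simpa using ht) (g * (σ c)⁻¹)
    rw [mul_inv_cancel_left, inv_mul_cancel_right] at this
    rw [← this, hy y hc, mul_assoc]

/-- For a finite family `τ` there is a finite window `u` of group elements, containing `1` and `τ`,
such that the overlap conditions between the windows at `g` and `g * σ c` force the entry for
`τ i` at `g` to be the entry for `1` at `g * τ i`. -/
theorem exists_window {σ : Fin k → G} (h : Subgroup.closure (Set.range σ) = ⊤) (τ : Fin l → G) :
    ∃ (N : ℕ) (u : Fin N → G) (o : Fin N) (q : Fin l → Fin N), u o = 1 ∧ (∀ i, u (q i) = τ i) ∧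
      ∀ y : G → Fin N → ℕ, (∀ j p c, u j = σ c * u p → ∀ g, y g j = y (g * σ c) p) →
        ∀ i g, y g (q i) = y (g * τ i) o := by
  classical
  choose S hS using exists_finset_forall_eq_mul_one h
  let W := insert 1 (Finset.univ.biUnion fun i => S (τ i))
  have hW (i) : S (τ i) ⊆ W := (Finset.subset_biUnion_of_mem (fun i => S (τ i))
    (Finset.mem_univ i)).trans (Finset.subset_insert _ _)
  have h1 : 1 ∈ W := Finset.mem_insert_self _ _
  have hτ (i) : τ i ∈ W := (hS (τ i) W (hW i)).1
  refine ⟨W.card, fun j => W.equivFin.symm j, W.equivFin ⟨1, h1⟩, fun i => W.equivFin ⟨τ i, hτ i⟩,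
    by simp, by simp, fun y hy i g => ?_⟩
  have := (hS (τ i) W (hW i)).2 (fun g s => if hs : s ∈ W then y g (W.equivFin ⟨s, hs⟩) else 0)
    (fun t ht c hc g => by
      simp only [ht, hc, dite_true]
      exact hy _ _ _ (by simp) _) g
  simpa only [hτ i, h1, dite_true] using this

/-- The `j`-th digit of `a` in base `m`. -/
def baseDigit (m a j : ℕ) : ℕ := a / m ^ j % m

/-- The letters `a`, `b`, read as windows in base `x.1`, overlap along the generator `c` as
prescribed by `E`, and the window `a` contains no pattern of the raw instance `x` between the
position `o` and the positions listed in `Q`. -/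
def Compatible (E : List (ℕ × ℕ × ℕ)) (Q : List (ℕ × ℕ)) (o : ℕ) (x : ℕ × List ℕ × ℕ)
    (a b c : ℕ) : Prop :=
  (∀ e ∈ E, e.2.2 = c → baseDigit x.1 a e.1 = baseDigit x.1 b e.2.1) ∧
    ∀ r ∈ Q, Nat.pair (baseDigit x.1 a o) (Nat.pair (baseDigit x.1 a r.2) r.1) ∉ x.2.1

open Classical in
/-- The instance whose letters are windows of `N` letters of `I`, and whose target letter is
`t`. -/
noncomputable def windowInstance (k N : ℕ) (E : List (ℕ × ℕ × ℕ)) (Q : List (ℕ × ℕ)) (o : ℕ)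
    (I : DomInstance l) (t : ℕ) : DomInstance k :=
  ⟨I.1 ^ N, Finset.univ.filter fun p => ¬ Compatible E Q o I.toRaw p.1 p.2.1 p.2.2,
    ⟨t % I.1 ^ N, Nat.mod_lt _ (Nat.pow_pos I.2.2.pos)⟩⟩

theorem mem_windowInstance {N : ℕ} {E : List (ℕ × ℕ × ℕ)} {Q : List (ℕ × ℕ)} {o : ℕ}
    {I : DomInstance l} {t : ℕ} (a b : Fin (I.1 ^ N)) (c : Fin k) :
    (a, b, c) ∈ (windowInstance k N E Q o I t).2.1 ↔ ¬ Compatible E Q o I.toRaw a b c := by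
  classical
  refine Finset.mem_filter.trans ?_
  simp only [Finset.mem_univ, true_and]

theorem rdp_iff_exists_windowInstance [Infinite G] {σ : Fin k → G} {τ : Fin l → G}
    (h : Subgroup.closure (Set.range σ) = ⊤) :
    ∃ (N : ℕ) (E : List (ℕ × ℕ × ℕ)) (Q : List (ℕ × ℕ)) (o : ℕ), ∀ I : DomInstance l,
      RDP G τ I ↔ ∃ t < I.1 ^ N, baseDigit I.1 t o = I.2.2 ∧
        RDP G σ (windowInstance k N E Q o I t) := by
  classical
  obtain ⟨N, u, o, q, hu, hq, hy⟩ := exists_window h τ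
  obtain ⟨c₀⟩ : Nonempty (Fin k) := by
    by_contra hk
    have := not_nonempty_iff.1 hk
    have hbot : (⊥ : Subgroup G) = ⊤ := by rw [← h, Set.range_eq_empty, Subgroup.closure_empty]
    exact not_subsingleton G (Subgroup.subsingleton_iff.1 (subsingleton_of_bot_eq_top hbot))
  let E : List (ℕ × ℕ × ℕ) := ((Finset.univ.filter fun e : Fin N × Fin N × Fin k =>
    u e.1 = σ e.2.2 * u e.2.1).toList.map fun e => (e.1, e.2.1, e.2.2))
  let Q : List (ℕ × ℕ) := (List.finRange l).map fun i : Fin l => ((i : ℕ), (q i : ℕ))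
  have hcomp (I : DomInstance l) (a b : ℕ) (c : Fin k) : Compatible E Q o I.toRaw a b c ↔
      (∀ j p, u j = σ c * u p → baseDigit I.1 a j = baseDigit I.1 b p) ∧
        ∀ i, Nat.pair (baseDigit I.1 a o) (Nat.pair (baseDigit I.1 a (q i)) i) ∉ I.toRaw.2.1 := by
    have : I.toRaw.1 = I.1 := rfl
    simp only [Compatible, E, Q, List.forall_mem_map, List.mem_finRange, Finset.mem_toList,
      Finset.mem_filter, Finset.mem_univ, true_and, Prod.forall, this]
    refine and_congr ⟨fun H j p hj => H j p c hj rfl, fun H j p c' hj hc => ?_⟩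
      ⟨fun H i => H i trivial, fun H i _ => H i⟩
    obtain rfl := Fin.ext hc
    exact H j p hj
  refine ⟨N, E, Q, o, fun I => ?_⟩
  have hmem (t : ℕ) (a b : Fin (I.1 ^ N)) (c : Fin k) :
      (a, b, c) ∉ (windowInstance k N E Q o I t).2.1 ↔ Compatible E Q o I.toRaw a b c :=
    (mem_windowInstance a b c).not.trans not_not
  have hdig (a : Fin (I.1 ^ N)) (j : Fin N) :
      baseDigit I.1 a j = (finFunctionFinEquiv.symm a j : Fin I.1) := rfl
  constructor
  · rintro ⟨x, hx, hinf⟩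
    let z (g : G) : Fin (I.1 ^ N) := finFunctionFinEquiv fun j => x (g * u j)
    have hz (g : G) (j : Fin N) : baseDigit I.1 (z g) j = x (g * u j) := by
      rw [hdig, Equiv.symm_apply_apply]
    obtain ⟨t, ht⟩ : ∃ t, ({g | x g = I.2.2} ∩ z ⁻¹' {t}).Infinite := by
      by_contra! H
      refine hinf ((Set.finite_iUnion H).subset fun g hg => ?_)
      exact Set.mem_iUnion.2 ⟨z g, hg, rfl⟩
    obtain ⟨g, hg, hgt⟩ := ht.nonempty
    refine ⟨t, t.2, ?_, z, fun g c => ?_, ht.mono fun g hg => ?_⟩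
    · rw [← show z g = t from hgt, hz, hu, mul_one, show x g = I.2.2 from hg]
    · refine (hmem t _ _ c).2 ((hcomp I _ _ c).2
        ⟨fun j p hj => by rw [hz, hz, hj, mul_assoc], fun i => ?_⟩)
      rw [hz, hz, hu, hq, mul_one, DomInstance.mem_toRaw]
      exact hx g i
    · exact hg.2.trans (Fin.ext (Nat.mod_eq_of_lt t.2).symm)
  · rintro ⟨t, htN, ht, z, hz, hinf⟩
    change G → Fin (I.1 ^ N) at z
    have hz' (g : G) (c : Fin k) := (hcomp I _ _ c).1 ((hmem t _ _ c).1 (hz g c))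
    have hread (i : Fin l) (g : G) : baseDigit I.1 (z g) (q i) = baseDigit I.1 (z (g * τ i)) o :=
      hy (fun g j => baseDigit I.1 (z g) j) (fun j p c hj g => (hz' g c).1 j p hj) i g
    refine ⟨fun g => finFunctionFinEquiv.symm (z g) o, fun g i => ?_, hinf.mono fun g hg => ?_⟩
    · have := (hz' g c₀).2 i
      rw [hread] at this
      rwa [← DomInstance.mem_toRaw]
    · have hg' : z g = ⟨t % I.1 ^ N, _⟩ := hg
      refine Fin.ext ?_
      rw [← ht, ← hdig, hg']
      simp only [Nat.mod_eq_of_lt htN]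

end Reduction

section Computability

theorem primrec_nat_pow : Primrec₂ ((· ^ ·) : ℕ → ℕ → ℕ) :=
  Primrec₂.unpaired'.1 Nat.Primrec.pow

theorem primrecRel_mem_list {α : Type*} [Primcodable α] :
    PrimrecRel fun (a : α) (l : List α) => a ∈ l :=
  (PrimrecPred.forall_mem_comp (p := fun (x : α × List α) b => ¬ b = x.1)
    (Primrec.eq.comp Primrec.snd (Primrec.fst.comp Primrec.fst)).not Primrec.snd).not.of_eq
      fun x => by simp

variable {α : Type*} [Primcodable α]

theorem primrec_baseDigit {m a j : α → ℕ} (hm : Primrec m) (ha : Primrec a) (hj : Primrec j) :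
    Primrec fun x => baseDigit (m x) (a x) (j x) :=
  Primrec.nat_mod.comp (Primrec.nat_div.comp ha (primrec_nat_pow.comp hm hj)) hm

theorem primrecPred_compatible (E : List (ℕ × ℕ × ℕ)) (Q : List (ℕ × ℕ)) (o : ℕ)
    {x : α → ℕ × List ℕ × ℕ} {a b c : α → ℕ} (hx : Primrec x) (ha : Primrec a) (hb : Primrec b)
    (hc : Primrec c) : PrimrecPred fun y => Compatible E Q o (x y) (a y) (b y) (c y) := by
  have hm := Primrec.fst.comp hx
  refine PrimrecPred.and ?_ ?_
  · refine PrimrecPred.forall_mem_comp (p := fun y e => e.2.2 = c y →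
      baseDigit (x y).1 (a y) e.1 = baseDigit (x y).1 (b y) e.2.1) ?_ (Primrec.const E)
    have he2 : Primrec fun z : α × ℕ × ℕ × ℕ => z.2.2 := Primrec.snd.comp Primrec.snd
    exact ((Primrec.eq.comp (Primrec.snd.comp he2) (hc.comp Primrec.fst)).not.or (Primrec.eq.comp
      (primrec_baseDigit (hm.comp Primrec.fst) (ha.comp Primrec.fst) (Primrec.fst.comp Primrec.snd))
      (primrec_baseDigit (hm.comp Primrec.fst) (hb.comp Primrec.fst) (Primrec.fst.comp he2)))).of_eq
        fun _ => imp_iff_not_or.symm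
  · refine PrimrecPred.forall_mem_comp (p := fun y r => Nat.pair (baseDigit (x y).1 (a y) o)
      (Nat.pair (baseDigit (x y).1 (a y) r.2) r.1) ∉ (x y).2.1) ?_ (Primrec.const Q)
    exact (primrecRel_mem_list.comp (Primrec₂.natPair.comp
      (primrec_baseDigit (hm.comp Primrec.fst) (ha.comp Primrec.fst) (Primrec.const o))
      (Primrec₂.natPair.comp (primrec_baseDigit (hm.comp Primrec.fst) (ha.comp Primrec.fst)
        (Primrec.snd.comp Primrec.snd)) (Primrec.fst.comp Primrec.snd)))
      (Primrec.fst.comp (Primrec.snd.comp (hx.comp Primrec.fst)))).not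

theorem PrimrecPred.iff {p q : α → Prop} (hp : PrimrecPred p) (hq : PrimrecPred q) :
    PrimrecPred fun a => p a ↔ q a :=
  ((hp.and hq).or (hp.not.and hq.not)).of_eq fun _ => iff_iff_and_or_not_and_not.symm

/-- The relation between the raw forms of `I` and of `windowInstance k N E Q o I t`. -/
def IsWindowInstance (k N : ℕ) (E : List (ℕ × ℕ × ℕ)) (Q : List (ℕ × ℕ)) (o : ℕ)
    (x : ℕ × List ℕ × ℕ) (t : ℕ) (x' : ℕ × List ℕ × ℕ) : Prop :=
  x'.1 = x.1 ^ N ∧ x'.2.2 = t % x.1 ^ N ∧ ∀ a < x'.1, ∀ b < x'.1, ∀ c < k,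
    (Nat.pair a (Nat.pair b c) ∈ x'.2.1 ↔ ¬ Compatible E Q o x a b c)

variable {k l : ℕ} (N : ℕ) (E : List (ℕ × ℕ × ℕ)) (Q : List (ℕ × ℕ)) (o : ℕ)

theorem isWindowInstance_iff (I : DomInstance l) (t : ℕ) (J : DomInstance k) :
    IsWindowInstance k N E Q o I.toRaw t J.toRaw ↔ J = windowInstance k N E Q o I t := by
  constructor
  · obtain ⟨m, F, a⟩ := J
    rintro ⟨h1, h2, h3⟩
    obtain rfl : m = I.1 ^ N := h1
    obtain rfl : a = ⟨t % I.1 ^ N, Nat.mod_lt _ (Nat.pow_pos I.2.2.pos)⟩ := Fin.ext h2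
    have : F = (windowInstance k N E Q o I t).2.1 := by
      ext ⟨a, b, c⟩
      exact (DomInstance.mem_toRaw (I := ⟨_, F, _⟩) a b c).symm.trans
        ((h3 a a.2 b b.2 c c.2).trans (mem_windowInstance a b c).symm)
    rw [this]
    rfl
  · rintro rfl
    refine ⟨rfl, rfl, fun a ha b hb c hc => ?_⟩
    exact (DomInstance.mem_toRaw ⟨a, ha⟩ ⟨b, hb⟩ ⟨c, hc⟩).trans
      (mem_windowInstance ⟨a, ha⟩ ⟨b, hb⟩ ⟨c, hc⟩)

theorem primrecPred_isWindowInstance : PrimrecPred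
    fun y : ((ℕ × List ℕ × ℕ) × ℕ) × ℕ × List ℕ × ℕ =>
      IsWindowInstance k N E Q o y.1.1 y.1.2 y.2 := by
  let X := ((ℕ × List ℕ × ℕ) × ℕ) × ℕ × List ℕ × ℕ
  have hx : Primrec fun y : X => y.1.1 := Primrec.fst.comp Primrec.fst
  have ht : Primrec fun y : X => y.1.2 := Primrec.snd.comp Primrec.fst
  have hx' : Primrec fun y : X => y.2 := Primrec.snd
  have hpow : Primrec fun y : X => y.1.1.1 ^ N :=
    primrec_nat_pow.comp (Primrec.fst.comp hx) (Primrec.const N)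
  have hm' : Primrec fun y : X => y.2.1 := Primrec.fst.comp hx'
  have hcore : PrimrecPred fun z : ((X × ℕ) × ℕ) × ℕ =>
      (Nat.pair z.1.1.2 (Nat.pair z.1.2 z.2) ∈ z.1.1.1.2.2.1 ↔
        ¬ Compatible E Q o z.1.1.1.1.1 z.1.1.2 z.1.2 z.2) := by
    have hy : Primrec fun z : ((X × ℕ) × ℕ) × ℕ => z.1.1.1 :=
      Primrec.fst.comp (Primrec.fst.comp Primrec.fst)
    have ha : Primrec fun z : ((X × ℕ) × ℕ) × ℕ => z.1.1.2 :=
      Primrec.snd.comp (Primrec.fst.comp Primrec.fst)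
    have hb : Primrec fun z : ((X × ℕ) × ℕ) × ℕ => z.1.2 := Primrec.snd.comp Primrec.fst
    exact (primrecRel_mem_list.comp
      (Primrec₂.natPair.comp ha (Primrec₂.natPair.comp hb Primrec.snd))
      (Primrec.fst.comp (Primrec.snd.comp (hx'.comp hy)))).iff
        (primrecPred_compatible E Q o (hx.comp hy) ha hb Primrec.snd).not
  have h1 : PrimrecPred fun z : (X × ℕ) × ℕ => ∀ c < k,
      (Nat.pair z.1.2 (Nat.pair z.2 c) ∈ z.1.1.2.2.1 ↔
        ¬ Compatible E Q o z.1.1.1.1 z.1.2 z.2 c) :=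
    PrimrecPred.forall_lt_comp hcore (Primrec.const k)
  have h2 : PrimrecPred fun z : X × ℕ => ∀ b < z.1.2.1, ∀ c < k,
      (Nat.pair z.2 (Nat.pair b c) ∈ z.1.2.2.1 ↔ ¬ Compatible E Q o z.1.1.1 z.2 b c) :=
    PrimrecPred.forall_lt_comp h1 (hm'.comp Primrec.fst)
  exact (Primrec.eq.comp hm' hpow).and ((Primrec.eq.comp (Primrec.snd.comp (Primrec.snd.comp hx'))
    (Primrec.nat_mod.comp ht hpow)).and (PrimrecPred.forall_lt_comp h2 hm'))

theorem computable_windowInstance :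
    Computable₂ (windowInstance (l := l) k N E Q o) := by
  classical
  have hP : ComputablePred fun p : (DomInstance l × ℕ) × ℕ =>
      IsWindowInstance k N E Q o p.1.1.toRaw p.1.2
        (Denumerable.ofNat (DomInstance k) p.2).toRaw := by
    obtain ⟨_, h⟩ := (primrecPred_isWindowInstance (k := k) N E Q o).computablePred
    refine ⟨inferInstance, (h.comp (((DomInstance.computable_toRaw.comp
      (Computable.fst.comp Computable.fst)).pair (Computable.snd.comp Computable.fst)).pair
        (DomInstance.computable_toRaw.comp
          ((Computable.ofNat (DomInstance k)).comp Computable.snd)))).of_eq fun p => ?_⟩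
    congr
  have hex (p : DomInstance l × ℕ) : ∃ n, IsWindowInstance k N E Q o p.1.toRaw p.2
      (Denumerable.ofNat (DomInstance k) n).toRaw := by
    obtain ⟨n, hn⟩ :=
      (Denumerable.eqv (DomInstance k)).symm.surjective (windowInstance k N E Q o p.1 p.2)
    exact ⟨n, (isWindowInstance_iff N E Q o _ _ _).2 hn⟩
  have hfind := Computable.find (P := fun (p : DomInstance l × ℕ) n =>
    IsWindowInstance k N E Q o p.1.toRaw p.2 (Denumerable.ofNat (DomInstance k) n).toRaw) hP hex
  refine ((Computable.ofNat (DomInstance k)).comp hfind).of_eq fun p => ?_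
  exact (isWindowInstance_iff N E Q o _ _ _).1 (Nat.find_spec (hex p))

theorem ComputablePred.exists_lt_comp {p : α → ℕ → Prop} {f : α → ℕ}
    (hp : ComputablePred fun x : α × ℕ => p x.1 x.2) (hf : Computable f) :
    ComputablePred fun a => ∃ n < f a, p a n := by
  classical
  have hrec : Computable fun a => (Nat.rec false (fun n b => b || decide (p a n)) (f a) : Bool) :=
    Computable.nat_rec hf (Computable.const false)
      (Primrec.or.to_comp.comp (Computable.snd.comp Computable.snd)
        (hp.decide.comp (Computable.fst.pair (Computable.fst.comp Computable.snd)))).to₂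
  refine ⟨fun a => Classical.dec _, hrec.of_eq fun a => ?_⟩
  have key (m : ℕ) : (Nat.rec false (fun n b => b || decide (p a n)) m : Bool) =
      decide (∃ n < m, p a n) := by
    induction m with
    | zero => simp
    | succ m ih =>
      simp only [ih, ← Bool.decide_or, Nat.lt_succ_iff_lt_or_eq, or_and_right,
        exists_or, exists_eq_left]
  exact (key (f a)).trans (decide_eq_decide.2 Iff.rfl)

end Computability

theorem RDP.computablePred_of_closure_eq_top {G : Type*} [Group G] {k l : ℕ} {σ : Fin k → G}
    (τ : Fin l → G) (h : Subgroup.closure (Set.range σ) = ⊤) (hσ : ComputablePred (RDP G σ)) :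
    ComputablePred (RDP G τ) := by
  classical
  cases finite_or_infinite G with
  | inl _ =>
    refine ⟨fun I => isFalse fun ⟨x, _, hx⟩ => hx (Set.toFinite _), ?_⟩
    exact Computable.const false
  | inr _ =>
    obtain ⟨N, E, Q, o, hred⟩ := rdp_iff_exists_windowInstance (τ := τ) h
    refine ComputablePred.of_eq (ComputablePred.exists_lt_comp ?_ ?_) fun I => (hred I).symm
    · have hraw : Computable fun p : DomInstance l × ℕ => p.1.toRaw :=
        DomInstance.computable_toRaw.comp Computable.fst
      have hdigit : Computable fun p : DomInstance l × ℕ =>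
          decide (baseDigit p.1.toRaw.1 p.2 o = p.1.toRaw.2.2) := by
        have : PrimrecPred fun y : (ℕ × List ℕ × ℕ) × ℕ => baseDigit y.1.1 y.2 o = y.1.2.2 :=
          Primrec.eq.comp
            (primrec_baseDigit (Primrec.fst.comp Primrec.fst) Primrec.snd (Primrec.const o))
            (Primrec.snd.comp (Primrec.snd.comp Primrec.fst))
        have hd := this.computablePred.decide.comp (hraw.pair Computable.snd)
        exact hd
      have hwindow : Computable fun p : DomInstance l × ℕ =>
          decide (RDP G σ (windowInstance k N E Q o p.1 p.2)) :=
        hσ.decide.comp (computable_windowInstance N E Q o)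
      refine ⟨fun p => instDecidableAnd,
        (Primrec.and.to_comp.comp hdigit hwindow).of_eq fun p => ?_⟩
      exact (Bool.decide_and _ _).symm
    · exact primrec_nat_pow.to_comp.comp
        (Computable.fst.comp DomInstance.computable_toRaw) (Computable.const N)

/-- The decidability of the recurring domino problem does not depend on the chosen
finite generating set. -/
theorem rdp_computablePred_iff_of_closure_eq_top {G : Type*} [Group G]
    {k₁ k₂ : ℕ} (σ₁ : Fin k₁ → G) (σ₂ : Fin k₂ → G)
    (h₁ : Subgroup.closure (Set.range σ₁) = ⊤)
    (h₂ : Subgroup.closure (Set.range σ₂) = ⊤) :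
    ComputablePred (RDP G σ₁) ↔ ComputablePred (RDP G σ₂) :=
  ⟨RDP.computablePred_of_closure_eq_top σ₂ h₁, RDP.computablePred_of_closure_eq_top σ₁ h₂⟩
end

section
/- Let G be a group, H ≤ G a subgroup, m k : ℕ, σ : Fin k → H a family of elements of H, F ⊆ Fin m × Fin m × Fin k, and a₀ : Fin m. Then there exists y : H → Fin m with (y h, y (h * σ i), i) ∉ F for all h : H and i : Fin k and with y 1 = a₀, if and only if there exists x : G → Fin m with (x g, x (g * ↑(σ i)), i) ∉ F for all g : G and i : Fin k (where ↑ is the coercion H → G) and with x 1 = a₀. -/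
/-- The seeded domino problem on a subgroup many-one reduces to the seeded
domino problem on the ambient group: for forbidden patterns supported on
generators of `H`, a seeded configuration exists on `H` iff one exists on `G`. -/
theorem seeded_subgroup_iff {G : Type*} [Group G] (H : Subgroup G)
    (m k : ℕ) (σ : Fin k → H) (F : Set (Fin m × Fin m × Fin k)) (a₀ : Fin m) :
    (∃ y : H → Fin m,
      (∀ (h : H) (i : Fin k), (y h, y (h * σ i), i) ∉ F) ∧ y 1 = a₀) ↔
    (∃ x : G → Fin m,
      (∀ (g : G) (i : Fin k), (x g, x (g * (σ i : G)), i) ∉ F) ∧ x 1 = a₀) := by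
  constructor
  · rintro ⟨y, hy, hy1⟩
    obtain ⟨S, hS, hS1⟩ := H.exists_isComplement_left 1
    refine ⟨fun g ↦ y (hS.equiv g).2, fun g i ↦ ?_, ?_⟩
    · simpa only [hS.equiv_mul_right] using hy (hS.equiv g).2 i
    · exact (congrArg (fun p ↦ y p.2) (hS.equiv_one hS1 H.one_mem)).trans hy1
  · rintro ⟨x, hx, hx1⟩
    exact ⟨fun h ↦ x h, fun h i ↦ hx h i, hx1⟩
end

section
/- Let G be a group, H ≤ G a subgroup, m k : ℕ, σ : Fin k → H a family of elements of H, F ⊆ Fin m × Fin m × Fin k, and a₀ : Fin m. If there exists y : H → Fin m with (y h, y (h * σ i), i) ∉ F for all h : H and i : Fin k and with {h : H | y h = a₀} infinite, then there exists x : G → Fin m with (x g, x (g * ↑(σ i)), i) ∉ F for all g : G and i : Fin k and with {g : G | x g = a₀} infinite. -/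
/-- A left transversal of a subgroup `H` yields a map `G → H` commuting with right
multiplication by `H`. -/
theorem Subgroup.exists_map_mul_right {G : Type*} [Group G] (H : Subgroup G) :
    ∃ φ : G → H, ∀ (g : G) (h : H), φ (g * h) = φ g * h := by
  refine ⟨fun g ↦ ⟨(g : G ⧸ H).out⁻¹ * g, QuotientGroup.eq.mp (QuotientGroup.out_eq' _)⟩,
    fun g h ↦ Subtype.ext ?_⟩
  simp [QuotientGroup.mk_mul_of_mem g h.2, mul_assoc]

/-- The recurring domino problem on a subgroup many-one reduces to the recurring
domino problem on the ambient group: a recurring configuration on `H` extends,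
by copying along a left transversal, to a recurring configuration on `G`. -/
theorem recurring_subgroup_extend {G : Type*} [Group G] (H : Subgroup G)
    (m k : ℕ) (σ : Fin k → H) (F : Set (Fin m × Fin m × Fin k)) (a₀ : Fin m)
    (hy : ∃ y : H → Fin m,
      (∀ (h : H) (i : Fin k), (y h, y (h * σ i), i) ∉ F) ∧
      {h : H | y h = a₀}.Infinite) :
    ∃ x : G → Fin m,
      (∀ (g : G) (i : Fin k), (x g, x (g * (σ i : G)), i) ∉ F) ∧
      {g : G | x g = a₀}.Infinite := by
  obtain ⟨y, hyF, hyInf⟩ := hy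
  obtain ⟨φ, hφ⟩ := H.exists_map_mul_right
  have hsurj : Function.Surjective φ := fun h ↦ ⟨1 * ((φ 1)⁻¹ * h : H), by rw [hφ]; group⟩
  refine ⟨y ∘ φ, fun g i ↦ ?_, hyInf.preimage fun h _ ↦ hsurj h⟩
  simpa only [Function.comp_apply, hφ] using hyF (φ g) i
end

section
/- Let G be a group and H ≤ G a subgroup of finite index (H.index ≠ 0). Let m k : ℕ, σ : Fin k → H a family of elements of H, F ⊆ Fin m × Fin m × Fin k, and a₀ : Fin m. Then there exists y : H → Fin m with (y h, y (h * σ i), i) ∉ F for all h : H and i : Fin k and with {h : H | y h = a₀} infinite, if and only if there exists x : G → Fin m with (x g, x (g * ↑(σ i)), i) ∉ F for all g : G and i : Fin k and with {g : G | x g = a₀} infinite. -/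
/-- For a finite-index subgroup `H ≤ G` and forbidden patterns supported on
generators of `H`, a recurring configuration exists on `H` iff one exists on
`G`. -/
theorem recurring_finiteIndex_iff {G : Type*} [Group G] (H : Subgroup G)
    (hind : H.index ≠ 0)
    (m k : ℕ) (σ : Fin k → H) (F : Set (Fin m × Fin m × Fin k)) (a₀ : Fin m) :
    (∃ y : H → Fin m,
      (∀ (h : H) (i : Fin k), (y h, y (h * σ i), i) ∉ F) ∧
      {h : H | y h = a₀}.Infinite) ↔
    (∃ x : G → Fin m,
      (∀ (g : G) (i : Fin k), (x g, x (g * (σ i : G)), i) ∉ F) ∧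
      {g : G | x g = a₀}.Infinite) := by
  obtain ⟨S, hS, h1⟩ := H.exists_isComplement_left 1
  constructor
  · rintro ⟨y, hy, hinf⟩
    refine ⟨fun g => y (hS.equiv g).2, fun g i => ?_, ?_⟩
    · simpa only [hS.equiv_mul_right] using hy (hS.equiv g).2 i
    · refine (hinf.image Subtype.val_injective.injOn).mono ?_
      rintro _ ⟨h, hh, rfl⟩
      have key : (hS.equiv (h : G)).2 = h :=
        hS.equiv_snd_eq_self_of_mem_of_one_mem h1 h.2
      simpa only [Set.mem_ofPred_eq, key] using hh
  · rintro ⟨x, hx, hinf⟩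
    have : H.FiniteIndex := ⟨hind⟩
    have hfin : Finite S := hS.finite_left
    obtain ⟨s, hs⟩ : ∃ s : S, {h : H | x (s * h) = a₀}.Infinite := by
      by_contra! hcon
      refine hinf ((Set.finite_iUnion fun s : S =>
        (hcon s).image fun h : H => (s : G) * h).subset fun g hg => ?_)
      have hmul := hS.equiv_fst_mul_equiv_snd g
      refine Set.mem_iUnion.2 ⟨(hS.equiv g).1, (hS.equiv g).2, ?_, hmul⟩
      change x _ = a₀
      rw [hmul]
      exact hg
    refine ⟨fun h => x (s * h), fun h i => ?_, hs⟩
    simpa only [Subgroup.coe_mul, mul_assoc] using hx (s * h) i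
end

section
/- Let G be a group, H a normal subgroup of G of finite index, and R : Finset G a right transversal of H containing 1, i.e. every g ∈ G can be written uniquely as h * r with h ∈ H and r ∈ R. Let m k : ℕ, σ : Fin k → G, and F ⊆ Fin m × Fin m × Fin k. Then there exist l : ℕ, a family τ : Fin l → H, and a finite set F' ⊆ (R → Fin m) × (R → Fin m) × Fin l, such that the map Ψ sending x : G → Fin m to the function Ψ(x) : H → (R → Fin m) defined by Ψ(x) h r = x (↑h * ↑r) restricts to a bijection from {x : G → Fin m | x avoids F with respect to σ} onto {y : H → (R → Fin m) | y avoids F' with respect to τ}. -/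
/-- The higher power shift of a nearest-neighbour `G`-SFT with respect to a
finite-index normal subgroup `H` and a right transversal `R` (containing `1`)
is again a nearest-neighbour SFT over `H`, on the alphabet of functions
`R → Fin m`: the map `Ψ x h r = x (h * r)` is a bijection between the two sets
of valid configurations. -/
theorem higher_power_shift_is_SFT {G : Type*} [Group G] (H : Subgroup G)
    [H.Normal] (hind : H.index ≠ 0) (R : Finset G)
    (hR : Subgroup.IsComplement (H : Set G) (R : Set G)) (h1 : (1 : G) ∈ R)
    (m k : ℕ) (σ : Fin k → G) (F : Set (Fin m × Fin m × Fin k)) :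
    ∃ (l : ℕ) (τ : Fin l → H)
      (F' : Finset ((R → Fin m) × (R → Fin m) × Fin l)),
      Set.BijOn (fun (x : G → Fin m) => fun (h : H) (r : R) => x (↑h * ↑r))
        {x : G → Fin m | ∀ (g : G) (i : Fin k), (x g, x (g * σ i), i) ∉ F}
        {y : H → (R → Fin m) |
          ∀ (h : H) (i : Fin l), (y h, y (h * τ i), i) ∉ F'} := by
  let e : H × R ≃ G := Equiv.ofBijective (fun p => (p.1 : G) * (p.2 : G)) hR
  have he : ∀ p : H × R, e p = (p.1 : G) * (p.2 : G) := fun _ => rfl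
  let c : Fin (Fintype.card (R × Fin k)) ≃ R × Fin k := (Fintype.equivFin _).symm
  let d : R × Fin k → H × R := fun q => e.symm ((q.1 : G) * σ q.2)
  have hd : ∀ q : R × Fin k, ((d q).1 : G) * ((d q).2 : G) = (q.1 : G) * σ q.2 := fun q =>
    e.apply_symm_apply _
  let F' : Set ((R → Fin m) × (R → Fin m) × Fin (Fintype.card (R × Fin k))) :=
    {t | (t.1 (c t.2.2).1, t.2.1 (d (c t.2.2)).2, (c t.2.2).2) ∈ F}
  have key : ∀ x : G → Fin m,
      (∀ (g : G) (i : Fin k), (x g, x (g * σ i), i) ∉ F) ↔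
        ∀ (h : H) (j : Fin (Fintype.card (R × Fin k))),
          ((fun r : R => x (↑h * ↑r)), (fun r : R => x (↑(h * (d (c j)).1) * ↑r)), j) ∉
            F'.toFinite.toFinset := by
    intro x
    simp only [Set.Finite.mem_toFinset, F', Set.mem_ofPred_eq, Subgroup.coe_mul, mul_assoc, hd]
    constructor
    · intro hx h j
      simpa only [mul_assoc] using hx (h * (c j).1) (c j).2
    · intro hx g i
      obtain ⟨⟨h, r⟩, rfl⟩ := e.surjective g
      simpa only [he, mul_assoc, Equiv.apply_symm_apply] using hx h (c.symm (r, i))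
  refine ⟨_, fun j => (d (c j)).1, F'.toFinite.toFinset, fun x hx => (key x).1 hx, ?_, ?_⟩
  · intro x _ x' _ hxx'
    funext g
    obtain ⟨⟨h, r⟩, rfl⟩ := e.surjective g
    exact congrFun (congrFun hxx' h) r
  · intro y hy
    let x : G → Fin m := fun g => y (e.symm g).1 (e.symm g).2
    have hxy : (fun (h : H) (r : R) => x (↑h * ↑r)) = y := by
      funext h r
      have hs : e.symm ((h : G) * (r : G)) = (h, r) := e.symm_apply_apply (h, r)
      simp only [x, hs]
    refine ⟨x, (key x).2 fun h j => ?_, hxy⟩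
    have hxy' : ∀ h : H, (fun r : R => x (↑h * ↑r)) = y h := congrFun hxy
    rw [hxy', hxy']
    exact hy h j
end
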